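/- arXiv:2205.10817 — 2 statements merged into one kernel-verified Lean document; each statement's English description precedes it below -/
import Mathlib

section
/- Let n = 2m ≥ 4 be an even integer and c_n = 2^{n-2}((n-2)/2)! π^{n/2}. Let u : ℝⁿ → ℝ be smooth and let Q : ℝⁿ → ℝ satisfy (-Δ)^m u = 2 Q e^{nu} on ℝⁿ, with f := Q e^{nu} ∈ L¹(ℝⁿ). Assume that for every δ > 0 there is R_δ > 0 such that Q(x) ≥ e^{-δ|x|²} for all |x| ≥ R_δ. Let v(x) = (1/c_n)∫_{ℝⁿ} log(|x-y|/|y|) f(y) dy. Then u(x) + v(x) = p(x) for all x, where p is a polynomial in n variables of degree at most n - 2. -/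
open MeasureTheory Real Filter Metric
open scoped ENNReal Topology

/-- The constant `c_n = 2^(n-2) * ((n-2)/2)! * pi^(n/2)`. -/
noncomputable def cconst (n : ℕ) : ℝ :=
  2 ^ (n - 2) * (Nat.factorial ((n - 2) / 2)) * Real.pi ^ (n / 2)

/-- The logarithmic potential `v x = (1/c_n) * ∫ log (|x-y|/|y|) f y dy`. -/
noncomputable def logPot (n : ℕ) (f : EuclideanSpace ℝ (Fin n) → ℝ)
    (x : EuclideanSpace ℝ (Fin n)) : ℝ :=
  (1 / cconst n) * ∫ y, Real.log (‖x - y‖ / ‖y‖) * f y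

/-- The Laplacian of `f : ℝ^n → ℝ`, as the trace of the second derivative. -/
noncomputable def laplacian {n : ℕ} (f : EuclideanSpace ℝ (Fin n) → ℝ)
    (x : EuclideanSpace ℝ (Fin n)) : ℝ :=
  ∑ i, iteratedFDeriv ℝ 2 f x ![EuclideanSpace.single i 1, EuclideanSpace.single i 1]

/-- The m-th iterate `(-Δ)^m` of the negative Laplacian. -/
noncomputable def negLapIter {n : ℕ} (m : ℕ) (f : EuclideanSpace ℝ (Fin n) → ℝ) :
    EuclideanSpace ℝ (Fin n) → ℝ :=
  (fun (g : EuclideanSpace ℝ (Fin n) → ℝ) x => -laplacian g x)^[m] f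


/-! ## The kernels `ph k y = (1 - |y|²)₊ ^ k` -/

abbrev EE (n : ℕ) := EuclideanSpace ℝ (Fin n)

noncomputable def ph {n : ℕ} (k : ℕ) (y : EE n) : ℝ := (max 0 (1 - ‖y‖ ^ 2)) ^ k

lemma ph_nonneg {n : ℕ} (k : ℕ) (y : EE n) : 0 ≤ ph k y := by
  unfold ph; positivity

lemma ph_le_one {n : ℕ} (k : ℕ) (y : EE n) : ph k y ≤ 1 := by
  unfold ph
  apply pow_le_one₀ (by positivity)
  apply max_le (by norm_num)
  nlinarith [sq_nonneg ‖y‖]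

lemma ph_continuous {n : ℕ} (k : ℕ) : Continuous (ph k : EE n → ℝ) := by
  unfold ph; fun_prop

lemma ph_eq_zero {n : ℕ} {k : ℕ} (hk : 1 ≤ k) {y : EE n} (hy : 1 ≤ ‖y‖) : ph k y = 0 := by
  unfold ph
  rw [max_eq_left (by nlinarith), zero_pow (by omega)]

lemma ph_compact {n : ℕ} {k : ℕ} (hk : 1 ≤ k) : HasCompactSupport (ph k : EE n → ℝ) := by
  apply HasCompactSupport.intro (isCompact_closedBall (0 : EE n) 1)
  intro y hy
  apply ph_eq_zero hk
  simp at hy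
  exact hy.le

lemma ph_mul_integrable {n : ℕ} {k : ℕ} (hk : 1 ≤ k) {g : EE n → ℝ} (hg : Continuous g) :
    Integrable (fun y => ph k y * g y) :=
  ((ph_continuous k).mul hg).integrable_of_hasCompactSupport ((ph_compact hk).mul_right)

lemma hasDerivAt_maxpow (k : ℕ) (hk : 1 ≤ k) (s : ℝ) :
    HasDerivAt (fun s : ℝ => (max 0 s) ^ (k + 1)) ((k + 1) * (max 0 s) ^ k) s := by
  rcases lt_trichotomy s 0 with h | h | h
  · rw [max_eq_left h.le, zero_pow (by omega), mul_zero]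
    apply (hasDerivAt_const s (0 : ℝ)).congr_of_eventuallyEq
    filter_upwards [Iio_mem_nhds h] with t ht
    rw [max_eq_left (le_of_lt ht), zero_pow (by omega)]
  · subst h
    rw [max_self, zero_pow (by omega), mul_zero]
    rw [hasDerivAt_iff_isLittleO]
    simp only [max_self, sub_zero, smul_zero]
    rw [zero_pow (by omega)]
    simp only [sub_zero]
    have h1 : (fun x : ℝ => (max 0 x) ^ (k + 1)) =O[𝓝 0] fun x : ℝ => x ^ (k + 1) := by
      apply Asymptotics.IsBigO.of_bound 1
      filter_upwards with x
      rw [one_mul, norm_pow, norm_pow]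
      gcongr
      simp only [Real.norm_eq_abs]
      rcases le_total 0 x with hx | hx
      · rw [max_eq_right hx]
      · rw [max_eq_left hx]; simp
    refine h1.trans_isLittleO ?_
    have := Asymptotics.isLittleO_pow_id (𝕜 := ℝ) (n := k + 1) (by omega)
    exact this
  · have := (hasDerivAt_pow (k + 1) s)
    rw [max_eq_right h.le]
    refine ((this.congr_deriv (by simp)).congr_of_eventuallyEq ?_)
    · filter_upwards [Ioi_mem_nhds h] with t ht
      rw [max_eq_right (le_of_lt ht)]

lemma ph_hasFDerivAt {n : ℕ} (k : ℕ) (hk : 1 ≤ k) (y : EE n) :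
    HasFDerivAt (ph (k + 1) : EE n → ℝ) ((-(2 * (k + 1) * ph k y)) • innerSL ℝ y) y := by
  have h1 : HasFDerivAt (fun y : EE n => 1 - ‖y‖ ^ 2) (-(2 • innerSL ℝ y)) y := by
    have := (hasStrictFDerivAt_norm_sq y).hasFDerivAt
    exact this.const_sub 1
  have h2 := (hasDerivAt_maxpow k hk (1 - ‖y‖ ^ 2)).comp_hasFDerivAt y h1
  refine h2.congr_fderiv ?_
  ext z
  simp [ph]
  ring

/-- The weighted mean of `w` around `x`. -/
noncomputable def AA {n : ℕ} (k : ℕ) (w : EE n → ℝ) (x : EE n) (r : ℝ) : ℝ :=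
  ∫ y, ph k y * w (x + r • y)

lemma AA_hasDerivAt_aux {n : ℕ} (k : ℕ) (hk : 1 ≤ k) (w : EE n → ℝ) (hw : ContDiff ℝ (⊤ : ℕ∞) w)
    (x : EE n) (r : ℝ) :
    HasDerivAt (AA k w x) (∫ y, ph k y * (fderiv ℝ w (x + r • y) y)) r := by
  have hcw : Continuous w := hw.continuous
  have hcdw : Continuous (fderiv ℝ w) := hw.continuous_fderiv (by simp)
  obtain ⟨C, hC⟩ := (isCompact_closedBall x (|r| + 1)).exists_bound_of_continuousOn
    (f := fderiv ℝ w) hcdw.continuousOn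
  have key := hasDerivAt_integral_of_dominated_loc_of_deriv_le (μ := (volume : Measure (EE n)))
    (bound := fun y => ph k y * C) (F := fun r y => ph k y * w (x + r • y))
    (F' := fun r y => ph k y * (fderiv ℝ w (x + r • y) y)) (x₀ := r) (s := ball r 1)
    (ball_mem_nhds r one_pos) ?_ ?_ ?_ ?_ ?_ ?_
  · exact key.2
  · filter_upwards with r'
    have := ph_continuous (n := n) k
    exact Continuous.aestronglyMeasurable (by fun_prop)
  · exact ph_mul_integrable hk (by fun_prop)
  · have := ph_continuous (n := n) k
    exact Continuous.aestronglyMeasurable (by fun_prop)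
  · filter_upwards with y r' hr'
    rw [norm_mul, Real.norm_of_nonneg (ph_nonneg k y)]
    rcases le_total 1 ‖y‖ with h | h
    · rw [ph_eq_zero hk h]; simp
    · gcongr
      · exact ph_nonneg k y
      have hr1 : |r'| ≤ |r| + 1 := by
        rw [mem_ball, Real.dist_eq] at hr'
        have := abs_sub_abs_le_abs_sub r' r
        linarith
      have hmem : x + r' • y ∈ closedBall x (|r| + 1) := by
        rw [mem_closedBall, dist_eq_norm, add_sub_cancel_left, norm_smul, Real.norm_eq_abs]
        calc |r'| * ‖y‖ ≤ |r'| * 1 := by gcongr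
          _ ≤ _ := by linarith
      have h2 := hC _ hmem
      calc ‖fderiv ℝ w (x + r' • y) y‖ ≤ ‖fderiv ℝ w (x + r' • y)‖ * ‖y‖ :=
            ContinuousLinearMap.le_opNorm _ _
        _ ≤ C * 1 := by
            gcongr
            exact (norm_nonneg _).trans h2
        _ = C := mul_one _
  · exact ph_mul_integrable hk continuous_const
  · filter_upwards with y r' hr'
    apply HasDerivAt.const_mul
    have h1 : HasDerivAt (fun r : ℝ => x + r • y) y r' := by
      simpa using ((hasDerivAt_id r').smul_const y).const_add x
    have h2 : HasFDerivAt w (fderiv ℝ w (x + r' • y)) (x + r' • y) :=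
      (hw.differentiable (by simp) _).hasFDerivAt
    exact h2.comp_hasDerivAt r' h1

lemma laplacian_eq {n : ℕ} (w : EE n → ℝ) (x : EE n) :
    laplacian w x = ∑ i, fderiv ℝ (fderiv ℝ w) x (EuclideanSpace.single i 1)
      (EuclideanSpace.single i 1) := by
  unfold laplacian
  simp [iteratedFDeriv_two_apply]

lemma laplacian_contDiff {n : ℕ} {w : EE n → ℝ} (hw : ContDiff ℝ (⊤ : ℕ∞) w) :
    ContDiff ℝ (⊤ : ℕ∞) (laplacian w) := by
  have : laplacian w = fun x => ∑ i, fderiv ℝ (fderiv ℝ w) x (EuclideanSpace.single i 1)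
      (EuclideanSpace.single i 1) := funext (laplacian_eq w)
  rw [this]
  have h1 : ContDiff ℝ (⊤ : ℕ∞) (fderiv ℝ w) := hw.fderiv_right (m := (⊤ : ℕ∞)) (by simp)
  have h2 : ContDiff ℝ (⊤ : ℕ∞) (fderiv ℝ (fderiv ℝ w)) :=
    h1.fderiv_right (m := (⊤ : ℕ∞)) (by simp)
  fun_prop

lemma AA_ibp {n : ℕ} (k : ℕ) (hk : 1 ≤ k) (w : EE n → ℝ) (hw : ContDiff ℝ (⊤ : ℕ∞) w)
    (x : EE n) (r : ℝ) :
    ∫ y, ph k y * (fderiv ℝ w (x + r • y) y) = r / (2 * (k + 1)) * AA (k + 1) (laplacian w) x r := by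
  have h1 : ContDiff ℝ (⊤ : ℕ∞) (fderiv ℝ w) := hw.fderiv_right (m := (⊤ : ℕ∞)) (by simp)
  have h2 : ContDiff ℝ (⊤ : ℕ∞) (fderiv ℝ (fderiv ℝ w)) :=
    h1.fderiv_right (m := (⊤ : ℕ∞)) (by simp)
  have hc1 := h1.continuous
  have hc2 := h2.continuous
  have hk0 : (0 : ℝ) < 2 * (k + 1) := by positivity
  let e : Fin n → EE n := fun i => EuclideanSpace.single i 1
  have hphd : ∀ y : EE n, fderiv ℝ (ph (k + 1)) y = (-(2 * (k + 1) * ph k y)) • innerSL ℝ y :=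
    fun y => (ph_hasFDerivAt k hk y).fderiv
  have hg : ∀ i, ∀ y, HasFDerivAt (fun y : EE n => fderiv ℝ w (x + r • y) (e i))
      (r • (fderiv ℝ (fderiv ℝ w) (x + r • y)).flip (e i)) y := by
    intro i y
    have ha : HasFDerivAt (fun y : EE n => x + r • y) (r • ContinuousLinearMap.id ℝ (EE n)) y :=
      ((hasFDerivAt_id y).const_smul r).const_add x
    have hb : HasFDerivAt (fderiv ℝ w) (fderiv ℝ (fderiv ℝ w) (x + r • y)) (x + r • y) :=
      (h1.differentiable (by simp) _).hasFDerivAt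
    have hc := (hb.comp y ha).clm_apply (hasFDerivAt_const (e i) y)
    refine hc.congr_fderiv ?_
    ext z
    simp
  have hmain : ∀ i, ∫ y, ph k y * (y i * fderiv ℝ w (x + r • y) (e i)) =
      r / (2 * (k + 1)) * ∫ y, ph (k + 1) y *
        fderiv ℝ (fderiv ℝ w) (x + r • y) (e i) (e i) := by
    intro i
    have key := integral_mul_fderiv_eq_neg_fderiv_mul_of_integrable (μ := (volume : Measure (EE n)))
      (f := ph (k + 1)) (g := fun y : EE n => fderiv ℝ w (x + r • y) (e i)) (v := e i) ?_ ?_ ?_ ?_ ?_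
    · simp only [hphd, (hg i _).fderiv] at key
      have e1 : ∀ y : EE n, ((-(2 * ((k : ℝ) + 1) * ph k y)) • innerSL ℝ y) (e i) *
          (fderiv ℝ w (x + r • y)) (e i) =
          (-(2 * (k + 1))) * (ph k y * (y i * fderiv ℝ w (x + r • y) (e i))) := by
        intro y
        simp [e, EuclideanSpace.inner_single_right]
        ring
      have e2 : ∀ y : EE n, ph (k + 1) y *
          (r • (fderiv ℝ (fderiv ℝ w) (x + r • y)).flip (e i)) (e i) =
          r * (ph (k + 1) y * fderiv ℝ (fderiv ℝ w) (x + r • y) (e i) (e i)) := by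
        intro y
        simp
        ring
      simp only [e1, e2, integral_const_mul] at key
      rw [div_mul_eq_mul_div, eq_div_iff hk0.ne']
      linarith
    · simp only [hphd]
      have := ph_mul_integrable hk (g := fun y : EE n => (-(2 * ((k : ℝ) + 1))) *
        (innerSL ℝ y (e i) * (fderiv ℝ w (x + r • y)) (e i))) (by fun_prop)
      refine this.congr (Filter.Eventually.of_forall fun y => ?_)
      simp; ring
    · simp only [(hg i _).fderiv]
      apply ph_mul_integrable (by omega)
      simp
      fun_prop
    · apply ph_mul_integrable (by omega)
      fun_prop
    · intro y _
      exact (ph_hasFDerivAt k hk y).differentiableAt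
    · intro y _
      exact (hg i y).differentiableAt
  have hdec : ∀ y : EE n, ∀ L : EE n →L[ℝ] ℝ, L y = ∑ i, y i * L (e i) := by
    intro y L
    conv_lhs => rw [← (EuclideanSpace.basisFun (Fin n) ℝ).sum_repr y]
    simp [e]
  have : ∀ y : EE n, ph k y * (fderiv ℝ w (x + r • y) y) =
      ∑ i, ph k y * (y i * fderiv ℝ w (x + r • y) (e i)) := by
    intro y
    rw [hdec y (fderiv ℝ w (x + r • y)), Finset.mul_sum]
  simp only [this]
  rw [integral_finsetSum]
  · simp only [hmain]
    rw [← Finset.mul_sum, ← integral_finsetSum]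
    · congr 1
      unfold AA
      congr 1
      ext y
      rw [laplacian_eq, Finset.mul_sum]
    · intro i _
      apply ph_mul_integrable (by omega)
      fun_prop
  · intro i _
    apply ph_mul_integrable hk
    fun_prop

lemma AA_continuous {n : ℕ} (k : ℕ) (hk : 1 ≤ k) (w : EE n → ℝ) (hw : ContDiff ℝ (⊤ : ℕ∞) w)
    (x : EE n) : Continuous (AA k w x) :=
  continuous_iff_continuousAt.2 fun r => (AA_hasDerivAt_aux k hk w hw x r).continuousAt

/-- Weighted means in the time variable. -/
noncomputable def BB {n : ℕ} (k : ℕ) (w : EE n → ℝ) (x : EE n) (t : ℝ) : ℝ :=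
  AA k w x (√(2 * t))

lemma BB_continuous {n : ℕ} (k : ℕ) (hk : 1 ≤ k) (w : EE n → ℝ) (hw : ContDiff ℝ (⊤ : ℕ∞) w)
    (x : EE n) : Continuous (BB k w x) :=
  (AA_continuous k hk w hw x).comp (by fun_prop)

lemma BB_hasDerivAt {n : ℕ} (k : ℕ) (hk : 1 ≤ k) (w : EE n → ℝ) (hw : ContDiff ℝ (⊤ : ℕ∞) w)
    (x : EE n) (t : ℝ) (ht : 0 < t) :
    HasDerivAt (BB k w x) (1 / (2 * (k + 1)) * BB (k + 1) (laplacian w) x t) t := by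
  have h1 := AA_hasDerivAt_aux k hk w hw x (√(2 * t))
  rw [AA_ibp k hk w hw] at h1
  have h2 : HasDerivAt (fun t : ℝ => √(2 * t)) (2 / (2 * √(2 * t))) t := by
    apply HasDerivAt.sqrt
    · simpa using (hasDerivAt_id t).const_mul 2
    · positivity
  have h3 := h1.comp t h2
  refine h3.congr_deriv ?_
  unfold BB
  have : √(2 * t) ≠ 0 := by positivity
  field_simp

/-! ## Taylor expansion and alternating sums -/

lemma taylor_gen (F : ℕ → ℝ → ℝ) (hc : ∀ j, Continuous (F j))
    (hd : ∀ j t, 0 < t → HasDerivAt (F j) (F (j + 1) t) t) (m : ℕ) (t : ℝ) (ht : 0 ≤ t) :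
    F 0 t = ∑ j ∈ Finset.range (m + 1), F j 0 * t ^ j / (Nat.factorial j) +
      ∫ s in (0 : ℝ)..t, (t - s) ^ m / (Nat.factorial m) * F (m + 1) s := by
  induction m with
  | zero =>
    have := intervalIntegral.integral_eq_sub_of_hasDeriv_right_of_le (f := F 0) (f' := F 1) ht
      (hc 0).continuousOn (fun x hx => (hd 0 x hx.1).hasDerivWithinAt)
      ((hc 1).intervalIntegrable _ _)
    simp [this]
  | succ m ih =>
    rw [ih, Finset.sum_range_succ _ (m + 1), add_assoc]
    congr 1
    have key := intervalIntegral.integral_mul_deriv_eq_deriv_mul_of_hasDerivAt (a := 0) (b := t)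
      (u := fun s => -((t - s) ^ (m + 1) / (Nat.factorial (m + 1) : ℝ))) (v := F (m + 1))
      (u' := fun s => (t - s) ^ m / (Nat.factorial m : ℝ)) (v' := F (m + 2))
      (by fun_prop) (hc _).continuousOn ?_ ?_ ?_ ((hc _).intervalIntegrable _ _)
    · simp only [sub_self, neg_mul, intervalIntegral.integral_neg] at key
      rw [zero_pow (by omega)] at key
      simp only [sub_zero] at key
      have e : F (m + 1) 0 * t ^ (m + 1) / (Nat.factorial (m + 1) : ℝ) =
        t ^ (m + 1) / (Nat.factorial (m + 1) : ℝ) * F (m + 1) 0 := by ring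
      rw [e]
      simp only [zero_div, zero_mul, neg_zero] at key
      linarith
    · intro s _
      have h1 : HasDerivAt (fun s : ℝ => (t - s)) (-1) s := by
        simpa using (hasDerivAt_id s).const_sub t
      have h2 := ((h1.pow (m + 1)).div_const (Nat.factorial (m + 1) : ℝ)).neg
      refine h2.congr_deriv ?_
      rw [Nat.factorial_succ]
      push_cast
      have : (Nat.factorial m : ℝ) ≠ 0 := by positivity
      have : (m + 1 : ℝ) ≠ 0 := by positivity
      simp
      field_simp
    · intro s hs
      rw [min_eq_left ht] at hs
      exact hd _ s hs.1
    · exact Continuous.intervalIntegrable (by fun_prop) _ _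

lemma alt_poly (M : ℕ) (P : Polynomial ℝ) (hP : P.natDegree < M) :
    ∑ i ∈ Finset.range (M + 1), (-1 : ℝ) ^ i * (M.choose i) * P.eval (i : ℝ) = 0 := by
  have h1 := congrFun (Polynomial.fwdDiff_iter_eq_zero_of_degree_lt hP) 0
  rw [fwdDiff_iter_eq_sum_shift] at h1
  simp only [Pi.zero_apply, zero_add, nsmul_eq_mul, mul_one] at h1
  have h2 : ∑ i ∈ Finset.range (M + 1), (-1 : ℝ) ^ i * (M.choose i) * P.eval (i : ℝ) =
    (-1) ^ M * ∑ i ∈ Finset.range (M + 1), ((-1 : ℤ) ^ (M - i) * (M.choose i)) • P.eval (i : ℝ) := by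
    rw [Finset.mul_sum]
    apply Finset.sum_congr rfl
    intro i hi
    have hi' : i ≤ M := by simp at hi; omega
    have : (-1 : ℝ) ^ i = (-1) ^ M * (-1) ^ (M - i) := by
      rw [← pow_add, show M + (M - i) = 2 * (M - i) + i by omega, pow_add, pow_mul]
      simp
    rw [this, zsmul_eq_mul]
    push_cast
    ring
  rw [h2, h1, mul_zero]

lemma alt_pow (M j : ℕ) (hj : j < M) (T : ℝ) :
    ∑ i ∈ Finset.range (M + 1), (-1 : ℝ) ^ i * (M.choose i) * ((i : ℝ) * T) ^ j = 0 := by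
  have := alt_poly M ((Polynomial.X * Polynomial.C T) ^ j) (by
    refine lt_of_le_of_lt (Polynomial.natDegree_pow_le) ?_
    have : (Polynomial.X * Polynomial.C T).natDegree ≤ 1 :=
      (Polynomial.natDegree_mul_C_le _ _).trans Polynomial.natDegree_X_le
    nlinarith)
  simpa only [Polynomial.eval_pow, Polynomial.eval_mul, Polynomial.eval_X, Polynomial.eval_C]
    using this

/-- The Peano (B-spline) kernel. -/
noncomputable def bb (M : ℕ) (T s : ℝ) : ℝ :=
  ∑ i ∈ Finset.range (M + 1), (-1 : ℝ) ^ i * (M.choose i) *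
    ((max 0 ((i : ℝ) * T - s)) ^ (M - 1) / (Nat.factorial (M - 1)))

lemma bb_continuous (M : ℕ) (T : ℝ) : Continuous (bb M T) := by
  unfold bb; fun_prop

lemma bb_eq_zero (M : ℕ) (hM : 2 ≤ M) (T s : ℝ) (hT : 0 < T) (hs : M * T ≤ s) : bb M T s = 0 := by
  unfold bb
  apply Finset.sum_eq_zero
  intro i hi
  have hi' : (i : ℝ) ≤ M := by simp at hi; exact_mod_cast (by omega : i ≤ M)
  rw [max_eq_left (by nlinarith), zero_pow (by omega)]
  simp

lemma bb_small (M : ℕ) (hM : 2 ≤ M) (T s : ℝ) (hs : 0 < s) (hs2 : s ≤ T) :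
    bb M T s = (-1) ^ M * (s ^ (M - 1) / (Nat.factorial (M - 1))) := by
  have h0 := alt_poly M (((Polynomial.X * Polynomial.C T) - Polynomial.C s) ^ (M - 1)) (by
    refine lt_of_le_of_lt (Polynomial.natDegree_pow_le) ?_
    have : (Polynomial.X * Polynomial.C T - Polynomial.C s).natDegree ≤ 1 := by
      rw [Polynomial.natDegree_sub_C]
      exact (Polynomial.natDegree_mul_C_le _ _).trans Polynomial.natDegree_X_le
    calc (M - 1) * _ ≤ (M - 1) * 1 := by gcongr
      _ < M := by omega)
  unfold bb
  rw [Finset.sum_range_succ'] at h0 ⊢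
  simp only [Polynomial.eval_pow, Polynomial.eval_sub, Polynomial.eval_mul, Polynomial.eval_X,
    Polynomial.eval_C] at h0
  have e : ∀ i ∈ Finset.range M, (-1 : ℝ) ^ (i + 1) * (M.choose (i + 1)) *
      ((max 0 (((i + 1 : ℕ) : ℝ) * T - s)) ^ (M - 1) / (Nat.factorial (M - 1))) =
      ((-1 : ℝ) ^ (i + 1) * (M.choose (i + 1)) *
      (((i + 1 : ℕ) : ℝ) * T - s) ^ (M - 1)) / (Nat.factorial (M - 1)) := by
    intro i _
    rw [max_eq_right]
    · ring
    · push_cast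
      have : (0 : ℝ) ≤ i := by positivity
      nlinarith
  rw [Finset.sum_congr rfl e, ← Finset.sum_div, eq_neg_of_add_eq_zero_left h0]
  have h3 : (max 0 (((0 : ℕ) : ℝ) * T - s)) = 0 := by
    apply max_eq_left; simp; exact hs.le
  rw [h3, zero_pow (by omega)]
  have h4 : ((-1 : ℝ)) ^ M = - (-1) ^ (M - 1) := by
    conv_lhs => rw [show M = (M - 1) + 1 by omega, pow_succ]
    ring
  have h5 : (-s) ^ (M - 1) = (-1) ^ (M - 1) * s ^ (M - 1) := by
    rw [← mul_pow]; simp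
  simp [h4, h5]
  ring

lemma bb_bound (M : ℕ) (hM : 2 ≤ M) : ∃ C : ℝ, 0 ≤ C ∧ ∀ T s : ℝ, 0 < T → 0 < s →
    |bb M T s| ≤ C * s ^ (M - 1) := by
  refine ⟨(∑ i ∈ Finset.range (M + 1), (M.choose i : ℝ) *
    ((M : ℝ) ^ (M - 1) / (Nat.factorial (M - 1)))) + 1, by positivity, ?_⟩
  intro T s hT hs
  rcases le_total s T with h | h
  · rw [bb_small M hM T s hs h, abs_mul, abs_pow, abs_neg, abs_one, one_pow, one_mul, abs_of_nonneg
      (by positivity)]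
    have : s ^ (M - 1) / (Nat.factorial (M - 1)) ≤ 1 * s ^ (M - 1) := by
      rw [one_mul]
      apply div_le_self (by positivity)
      exact_mod_cast Nat.one_le_iff_ne_zero.2 (Nat.factorial_ne_zero _)
    refine this.trans ?_
    gcongr
    have : (0 : ℝ) ≤ ∑ i ∈ Finset.range (M + 1), (M.choose i : ℝ) *
      ((M : ℝ) ^ (M - 1) / (Nat.factorial (M - 1))) := by positivity
    linarith
  · have : |bb M T s| ≤ (∑ i ∈ Finset.range (M + 1), (M.choose i : ℝ) *
      ((M : ℝ) ^ (M - 1) / (Nat.factorial (M - 1)))) * s ^ (M - 1) := by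
      unfold bb
      refine (Finset.abs_sum_le_sum_abs _ _).trans ?_
      rw [Finset.sum_mul]
      apply Finset.sum_le_sum
      intro i hi
      have hi' : (i : ℝ) ≤ M := by simp at hi; exact_mod_cast (by omega : i ≤ M)
      rw [abs_mul, abs_mul, abs_pow, abs_neg, abs_one, one_pow, one_mul, abs_of_nonneg
        (by positivity), abs_of_nonneg (by positivity), mul_assoc]
      apply mul_le_mul_of_nonneg_left _ (by positivity)
      rw [div_mul_eq_mul_div, ← mul_pow]
      gcongr
      apply max_le (by positivity)
      have : (i : ℝ) * T ≤ M * s := by gcongr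
      linarith
    refine this.trans ?_
    gcongr
    linarith

lemma alt_sum (F : ℕ → ℝ → ℝ) (hc : ∀ j, Continuous (F j))
    (hd : ∀ j t, 0 < t → HasDerivAt (F j) (F (j + 1) t) t) (M : ℕ) (hM : 2 ≤ M) (T : ℝ)
    (hT : 0 < T) :
    ∑ i ∈ Finset.range (M + 1), (-1 : ℝ) ^ i * (M.choose i) * F 0 (i * T) =
      ∫ s in Set.Ioi (0 : ℝ), bb M T s * F M s := by
  obtain ⟨m, rfl⟩ : ∃ m, M = m + 1 := ⟨M - 1, by omega⟩
  have h1 : ∀ i ∈ Finset.range (m + 1 + 1), (-1 : ℝ) ^ i * ((m + 1).choose i) * F 0 (i * T) =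
      (∑ j ∈ Finset.range (m + 1), F j 0 / (Nat.factorial j) *
        ((-1 : ℝ) ^ i * ((m + 1).choose i) * ((i : ℝ) * T) ^ j)) +
      ∫ s in Set.Ioi (0 : ℝ), (-1 : ℝ) ^ i * ((m + 1).choose i) *
        ((max 0 ((i : ℝ) * T - s)) ^ m / (Nat.factorial m)) * F (m + 1) s := by
    intro i _
    have hiT : 0 ≤ (i : ℝ) * T := by positivity
    rw [taylor_gen F hc hd m _ hiT, mul_add, Finset.mul_sum]
    congr 1
    · apply Finset.sum_congr rfl
      intro j _
      ring
    · rw [intervalIntegral.integral_of_le hiT, ← integral_const_mul]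
      rw [← integral_indicator measurableSet_Ioc, ← integral_indicator measurableSet_Ioi]
      congr 1
      ext s
      simp only [Set.indicator_apply, Set.mem_Ioc, Set.mem_Ioi]
      by_cases h0 : 0 < s
      · by_cases h1 : s ≤ i * T
        · rw [if_pos ⟨h0, h1⟩, if_pos h0, max_eq_right (by linarith)]
          ring
        · rw [if_neg (fun h => h1 h.2), if_pos h0, max_eq_left (by linarith), zero_pow (by omega)]
          simp
      · rw [if_neg (fun h => h0 h.1), if_neg h0]
  rw [Finset.sum_congr rfl h1, Finset.sum_add_distrib, Finset.sum_comm]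
  have h2 : ∑ j ∈ Finset.range (m + 1), ∑ i ∈ Finset.range (m + 1 + 1),
      F j 0 / (Nat.factorial j) * ((-1 : ℝ) ^ i * ((m + 1).choose i) * ((i : ℝ) * T) ^ j) = 0 := by
    apply Finset.sum_eq_zero
    intro j hj
    rw [← Finset.mul_sum, alt_pow _ _ (by simpa using hj), mul_zero]
  rw [h2, zero_add, ← integral_finsetSum]
  · congr 1
    ext s
    unfold bb
    rw [Finset.sum_mul]
    simp
  · intro i _
    have hF := hc (m + 1)
    have hcont : Continuous fun s : ℝ => (-1 : ℝ) ^ i * ((m + 1).choose i) *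
        ((max 0 ((i : ℝ) * T - s)) ^ m / (Nat.factorial m)) * F (m + 1) s := by fun_prop
    have h5 : IntegrableOn (fun s : ℝ => (-1 : ℝ) ^ i * ((m + 1).choose i) *
        ((max 0 ((i : ℝ) * T - s)) ^ m / (Nat.factorial m)) * F (m + 1) s) (Set.Ioc 0 (i * T)) :=
      (hcont.integrableOn_Icc).mono_set Set.Ioc_subset_Icc_self
    refine IntegrableOn.of_forall_sdiff_eq_zero h5 measurableSet_Ioi ?_
    intro s hs
    have : i * T ≤ s := by
      by_contra h
      exact hs.2 ⟨hs.1, (not_le.1 h).le⟩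
    rw [max_eq_left (by linarith), zero_pow (by omega)]
    simp

/-! ## The logarithmic kernel -/

noncomputable def hh (p : ℕ) (τ : ℝ) : ℝ := (max 0 (1 - τ)) ^ p

lemma hh_continuous (p : ℕ) : Continuous (hh p) := by unfold hh; fun_prop

lemma hh_nonneg (p : ℕ) (τ : ℝ) : 0 ≤ hh p τ := by unfold hh; positivity

lemma hh_le_one (p : ℕ) {τ : ℝ} (hτ : 0 ≤ τ) : hh p τ ≤ 1 := by
  unfold hh
  exact pow_le_one₀ (by positivity) (max_le (by norm_num) (by linarith))

lemma hh_lip (p : ℕ) {σ τ : ℝ} (hσ : 0 ≤ σ) (hτ : 0 ≤ τ) :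
    |hh p σ - hh p τ| ≤ p * |max 0 (1 - σ) - max 0 (1 - τ)| := by
  unfold hh
  refine (abs_pow_sub_pow_le _ _ p).trans ?_
  have : max |max 0 (1 - σ)| |max 0 (1 - τ)| ^ (p - 1) ≤ 1 := by
    apply pow_le_one₀ (by positivity)
    apply max_le <;> rw [abs_of_nonneg (by positivity)] <;>
      exact max_le (by norm_num) (by linarith)
  calc |max 0 (1 - σ) - max 0 (1 - τ)| * p * _ ≤ |max 0 (1 - σ) - max 0 (1 - τ)| * p * 1 := by
        gcongr
    _ = _ := by ring

lemma hh_lip1 (p : ℕ) {σ τ : ℝ} (hσ : 0 ≤ σ) (hτ : 0 ≤ τ) :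
    |hh p σ - hh p τ| ≤ p * |σ - τ| := by
  refine (hh_lip p hσ hτ).trans ?_
  apply mul_le_mul_of_nonneg_left _ (by positivity)
  have := abs_max_sub_max_le_abs (1 - σ) (1 - τ) 0
  rw [max_comm 0, max_comm 0]
  refine this.trans (le_of_eq ?_)
  rw [abs_sub_comm]
  congr 1
  ring

lemma hh_lip2 (p : ℕ) {a b : ℝ} (ha : 0 ≤ a) (hb : 0 ≤ b) :
    |hh p (a ^ 2) - hh p (b ^ 2)| ≤ 2 * p * |a - b| := by
  refine (hh_lip p (sq_nonneg a) (sq_nonneg b)).trans ?_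
  have key : ∀ a b : ℝ, 0 ≤ a → 0 ≤ b → a ≤ b →
      |max 0 (1 - a ^ 2) - max 0 (1 - b ^ 2)| ≤ 2 * |a - b| := by
    intro a b ha hb hab
    rw [abs_of_nonneg, abs_of_nonpos (by linarith)]
    · rcases le_total 1 b with h | h
      · rw [max_eq_left (by nlinarith : 1 - b ^ 2 ≤ 0)]
        rcases le_total 1 a with h' | h'
        · rw [max_eq_left (by nlinarith : 1 - a ^ 2 ≤ 0)]; linarith
        · rw [max_eq_right (by nlinarith)]; nlinarith
      · rw [max_eq_right (by nlinarith), max_eq_right (by nlinarith)]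
        nlinarith
    · rw [sub_nonneg]
      apply max_le_max le_rfl
      nlinarith
  have : |max 0 (1 - a ^ 2) - max 0 (1 - b ^ 2)| ≤ 2 * |a - b| := by
    rcases le_total a b with h | h
    · exact key a b ha hb h
    · rw [abs_sub_comm, abs_sub_comm a b]
      exact key b a hb ha h
  calc (p : ℝ) * _ ≤ p * (2 * |a - b|) := by gcongr
    _ = _ := by ring

lemma hh_frullani (p : ℕ) (hp : 1 ≤ p) {a b : ℝ} (ha : 0 < a) (hb : 0 < b) :
    IntegrableOn (fun s : ℝ => s⁻¹ * (hh p (a / s) - hh p (b / s))) (Set.Ioi 0) ∧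
    ∫ s in Set.Ioi (0 : ℝ), s⁻¹ * (hh p (a / s) - hh p (b / s)) = log (b / a) := by
  have hint : IntegrableOn (fun s : ℝ => s⁻¹ * (hh p (a / s) - hh p (b / s))) (Set.Ioi 0) := by
    have hmin : 0 < min a b := lt_min ha hb
    have hmeas : Measurable (fun s : ℝ => s⁻¹ * (hh p (a / s) - hh p (b / s))) := by
      unfold hh; fun_prop
    have h1 : IntegrableOn (fun s : ℝ => s⁻¹ * (hh p (a / s) - hh p (b / s)))
        (Set.Ioi (min a b)) := by
      have h2 := (integrableOn_Ioi_rpow_of_lt (show (-2 : ℝ) < -1 by norm_num) hmin).const_mul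
        (p * |a - b|)
      refine Integrable.mono' h2 hmeas.aestronglyMeasurable ?_
      filter_upwards [ae_restrict_mem measurableSet_Ioi] with s hs
      have hs0 : 0 < s := hmin.trans hs
      rw [norm_mul, norm_inv, Real.norm_of_nonneg hs0.le, Real.norm_eq_abs]
      have h3 := hh_lip1 p (div_nonneg ha.le hs0.le) (div_nonneg hb.le hs0.le)
      have h4 : |a / s - b / s| = |a - b| / s := by
        rw [← sub_div, abs_div, abs_of_pos hs0]
      rw [h4] at h3
      have h5 : s ^ (-2 : ℝ) = s⁻¹ * s⁻¹ := by
        rw [rpow_neg hs0.le]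
        norm_cast
        rw [pow_two, mul_inv]
      calc s⁻¹ * _ ≤ s⁻¹ * (p * (|a - b| / s)) := by gcongr
        _ = _ := by rw [h5]; field_simp
    refine IntegrableOn.of_forall_sdiff_eq_zero h1 measurableSet_Ioi ?_
    intro s hs
    have hs0 : 0 < s := hs.1
    have hs1 : s ≤ min a b := not_lt.1 hs.2
    have e : ∀ c, s ≤ c → hh p (c / s) = 0 := by
      intro c hc
      unfold hh
      rw [max_eq_left, zero_pow (by omega)]
      have := (one_le_div hs0).2 hc
      linarith
    rw [e a (hs1.trans (min_le_left _ _)), e b (hs1.trans (min_le_right _ _))]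
    simp
  refine ⟨hint, ?_⟩
  have key := Frullani.integral_Ioi_eq (f := fun σ : ℝ => hh p σ⁻¹) (a := a⁻¹) (b := b⁻¹)
    (L := 0) (R := 1) ?_ (by positivity) (by positivity) ?_ ?_ ?_
  · have e : ∀ c s : ℝ, (c⁻¹ * s)⁻¹ = c / s := by
      intro c s; rw [mul_inv, inv_inv]; rfl
    simp only [e, smul_eq_mul] at key
    rw [key]
    rw [show b⁻¹ / a⁻¹ = (b / a)⁻¹ by field_simp, log_inv]
    ring
  · apply ContinuousOn.locallyIntegrableOn _ measurableSet_Ioi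
    apply (hh_continuous p).comp_continuousOn
    apply continuousOn_inv₀.mono
    intro s hs
    exact ne_of_gt hs
  · apply tendsto_const_nhds.congr'
    filter_upwards [Ioo_mem_nhdsGT (show (0 : ℝ) < 1 by norm_num)] with s hs
    unfold hh
    rw [max_eq_left, zero_pow (by omega)]
    have := (one_le_inv₀ hs.1).2 hs.2.le
    linarith
  · have h1 : hh p 0 = 1 := by simp [hh]
    rw [← h1]
    exact ((hh_continuous p).tendsto 0).comp tendsto_inv_atTop_zero
  · have e : ∀ c s : ℝ, (c⁻¹ * s)⁻¹ = c / s := by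
      intro c s; rw [mul_inv, inv_inv]; rfl
    simpa only [e, smul_eq_mul] using hint

/-- Normalised Peano kernel. -/
noncomputable def chi (M : ℕ) (T s : ℝ) : ℝ :=
  (-1) ^ M * (Nat.factorial (M - 1)) * bb M T s / s ^ (M - 1)

lemma chi_measurable (M : ℕ) (T : ℝ) : Measurable (chi M T) := by
  have := (bb_continuous M T).measurable
  unfold chi; fun_prop

lemma chi_small (M : ℕ) (hM : 2 ≤ M) (T s : ℝ) (hs : 0 < s) (hs2 : s ≤ T) : chi M T s = 1 := by
  unfold chi
  rw [bb_small M hM T s hs hs2]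
  have : (Nat.factorial (M - 1) : ℝ) ≠ 0 := by positivity
  field_simp
  rw [← pow_mul, mul_comm, pow_mul]; simp

lemma chi_bound (M : ℕ) (hM : 2 ≤ M) : ∃ C : ℝ, 0 ≤ C ∧ ∀ T s : ℝ, 0 < T → 0 < s →
    |chi M T s| ≤ C := by
  obtain ⟨C, hC0, hC⟩ := bb_bound M hM
  refine ⟨(Nat.factorial (M - 1)) * C, by positivity, ?_⟩
  intro T s hT hs
  unfold chi
  rw [abs_div, abs_mul, abs_mul, abs_pow, abs_neg, abs_one, one_pow, one_mul,
    abs_of_nonneg (by positivity : (0 : ℝ) ≤ (Nat.factorial (M - 1) : ℝ)),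
    abs_of_pos (by positivity : 0 < s ^ (M - 1)), div_le_iff₀ (by positivity), mul_assoc]
  gcongr
  exact hC T s hT hs

lemma kernel_est {n : ℕ} (M p : ℕ) (hM : 2 ≤ M) (hp : 1 ≤ p) : ∃ C : ℝ, 0 ≤ C ∧
    ∀ T : ℝ, 0 < T → ∀ x z : EE n, z ≠ 0 → z ≠ x →
    |(∫ s in Set.Ioi (0 : ℝ), chi M T s * (s⁻¹ * (hh p (‖z - x‖ ^ 2 / 2 / s)
        - hh p (‖z‖ ^ 2 / 2 / s)))) + 2 * log (‖x - z‖ / ‖z‖)| ≤ C * ‖x‖ / √T := by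
  obtain ⟨C, hC0, hC⟩ := chi_bound M hM
  refine ⟨(C + 1) * (2 * p) * 2, by positivity, ?_⟩
  intro T hT x z hz hzx
  have hn1 : 0 < ‖z‖ := norm_pos_iff.2 hz
  have hn2 : 0 < ‖z - x‖ := norm_pos_iff.2 (sub_ne_zero.2 hzx)
  obtain ⟨hint, hval⟩ := hh_frullani p hp (a := ‖z - x‖ ^ 2 / 2) (b := ‖z‖ ^ 2 / 2)
    (by positivity) (by positivity)
  set D : ℝ → ℝ := fun s => s⁻¹ * (hh p (‖z - x‖ ^ 2 / 2 / s) - hh p (‖z‖ ^ 2 / 2 / s)) with hD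
  have hlog : log (‖z‖ ^ 2 / 2 / (‖z - x‖ ^ 2 / 2)) = - (2 * log (‖x - z‖ / ‖z‖)) := by
    rw [show ‖z‖ ^ 2 / 2 / (‖z - x‖ ^ 2 / 2) = ((‖z - x‖ / ‖z‖) ^ 2)⁻¹ by field_simp, log_inv,
      log_pow, norm_sub_rev]
    simp
  rw [hlog] at hval
  have hint2 : IntegrableOn (fun s => chi M T s * D s) (Set.Ioi 0) := by
    refine hint.bdd_mul (c := C) (chi_measurable M T).aestronglyMeasurable ?_
    filter_upwards [ae_restrict_mem measurableSet_Ioi] with s hs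
    exact hC T s hT hs
  have h1 : (∫ s in Set.Ioi (0 : ℝ), chi M T s * D s) + 2 * log (‖x - z‖ / ‖z‖) =
      ∫ s in Set.Ioi (0 : ℝ), (chi M T s - 1) * D s := by
    have : ∀ s, (chi M T s - 1) * D s = chi M T s * D s - D s := fun s => by ring
    simp only [this]
    rw [integral_sub hint2 hint, hval]
    ring
  have hgoal : |(∫ s in Set.Ioi (0 : ℝ), chi M T s * D s) + 2 * log (‖x - z‖ / ‖z‖)| ≤
      (C + 1) * (2 * p) * 2 * ‖x‖ / √T := by
    rw [h1]
    have h2 : ∫ s in Set.Ioi (0 : ℝ), (chi M T s - 1) * D s =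
        ∫ s in Set.Ioi T, (chi M T s - 1) * D s := by
      apply setIntegral_eq_of_subset_of_forall_sdiff_eq_zero measurableSet_Ioi
        (Set.Ioi_subset_Ioi hT.le)
      intro s hs
      rw [chi_small M hM T s hs.1 (not_lt.1 hs.2)]
      simp
    rw [h2, ← Real.norm_eq_abs]
    have h3 := (integrableOn_Ioi_rpow_of_lt (show (-(3 / 2) : ℝ) < -1 by norm_num) hT).const_mul
        ((C + 1) * (2 * p) * ‖x‖)
    have h4 := norm_integral_le_of_norm_le (f := fun s => (chi M T s - 1) * D s) h3 (by
      filter_upwards [ae_restrict_mem measurableSet_Ioi] with s hs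
      have hs0 : 0 < s := hT.trans hs
      have hsq : 0 < √s := Real.sqrt_pos.2 hs0
      have e1 : ∀ q : EE n, ‖q‖ ^ 2 / 2 / s = (‖q‖ / √(2 * s)) ^ 2 := by
        intro q
        rw [div_pow, Real.sq_sqrt (by positivity), div_div]
      rw [norm_mul]
      have e2 : ‖D s‖ ≤ (2 * p) * ‖x‖ * s ^ (-(3 / 2) : ℝ) := by
        simp only [hD]
        rw [e1, e1, norm_mul, norm_inv, Real.norm_of_nonneg hs0.le, Real.norm_eq_abs]
        have e3 := hh_lip2 p (a := ‖z - x‖ / √(2 * s)) (b := ‖z‖ / √(2 * s)) (by positivity)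
          (by positivity)
        have e4 : |‖z - x‖ / √(2 * s) - ‖z‖ / √(2 * s)| ≤ ‖x‖ / √s := by
          rw [← sub_div, abs_div, abs_of_nonneg (Real.sqrt_nonneg _)]
          have : |‖z - x‖ - ‖z‖| ≤ ‖x‖ := by
            refine (abs_norm_sub_norm_le _ _).trans ?_
            simp
          gcongr
          linarith
        have e5 : s ^ (-(3 / 2) : ℝ) = s⁻¹ * (√s)⁻¹ := by
          rw [Real.sqrt_eq_rpow, ← rpow_neg_one, ← rpow_neg_one, ← rpow_mul hs0.le, ← rpow_add hs0]
          norm_num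
        rw [e5]
        calc s⁻¹ * _ ≤ s⁻¹ * (2 * p * (‖x‖ / √s)) := by
              gcongr
              exact e3.trans (by gcongr)
          _ = _ := by field_simp
      have e6 : ‖chi M T s - 1‖ ≤ C + 1 := by
        refine (norm_sub_le _ _).trans ?_
        have := hC T s hT hs0
        simp only [Real.norm_eq_abs, abs_one]
        linarith
      calc _ ≤ (C + 1) * ((2 * p) * ‖x‖ * s ^ (-(3 / 2) : ℝ)) := by gcongr
        _ = _ := by ring)
    refine h4.trans (le_of_eq ?_)
    rw [integral_const_mul, integral_Ioi_rpow_of_lt (by norm_num) hT]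
    have e7 : T ^ (-(3 / 2) + 1 : ℝ) = (√T)⁻¹ := by
      rw [Real.sqrt_eq_rpow, ← rpow_neg_one, ← rpow_mul hT.le]
      norm_num
    rw [e7]
    have : 0 < √T := Real.sqrt_pos.2 hT
    field_simp
    norm_num
  exact hgoal

/-! ## The representation formula -/

noncomputable def cc (k j : ℕ) : ℝ := ∏ i ∈ Finset.range j, (1 / (2 * (((k + i : ℕ) : ℝ) + 1)))

lemma lap_iter_contDiff {n : ℕ} {u : EE n → ℝ} (hu : ContDiff ℝ (⊤ : ℕ∞) u) (j : ℕ) :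
    ContDiff ℝ (⊤ : ℕ∞) (laplacian^[j] u) := by
  induction j with
  | zero => simpa using hu
  | succ j ih =>
    rw [Function.iterate_succ_apply']
    exact laplacian_contDiff ih

noncomputable def FF {n : ℕ} (k : ℕ) (u : EE n → ℝ) (x : EE n) (j : ℕ) (t : ℝ) : ℝ :=
  cc k j * BB (k + j) (laplacian^[j] u) x t

lemma FF_continuous {n : ℕ} (k : ℕ) (hk : 1 ≤ k) {u : EE n → ℝ} (hu : ContDiff ℝ (⊤ : ℕ∞) u)
    (x : EE n) (j : ℕ) : Continuous (FF k u x j) :=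
  (BB_continuous (k + j) (by omega) _ (lap_iter_contDiff hu j) x).const_mul _

lemma FF_hasDerivAt {n : ℕ} (k : ℕ) (hk : 1 ≤ k) {u : EE n → ℝ} (hu : ContDiff ℝ (⊤ : ℕ∞) u)
    (x : EE n) (j : ℕ) (t : ℝ) (ht : 0 < t) :
    HasDerivAt (FF k u x j) (FF k u x (j + 1) t) t := by
  have := (BB_hasDerivAt (k + j) (by omega) _ (lap_iter_contDiff hu j) x t ht).const_mul (cc k j)
  refine this.congr_deriv ?_
  unfold FF
  rw [Function.iterate_succ_apply', cc, cc, Finset.prod_range_succ]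
  rw [← add_assoc]
  ring

lemma ph_scale {n : ℕ} (p : ℕ) (z : EE n) {s : ℝ} (hs : 0 < s) :
    ph p ((√(2 * s))⁻¹ • z) = hh p (‖z‖ ^ 2 / 2 / s) := by
  unfold ph hh
  rw [norm_smul, norm_inv, Real.norm_of_nonneg (Real.sqrt_nonneg _), mul_pow, inv_pow,
    Real.sq_sqrt (by positivity)]
  congr 3
  field_simp

lemma BB_eq {m : ℕ} (p : ℕ) (w : EE (2 * m) → ℝ) (x : EE (2 * m)) {s : ℝ} (hs : 0 < s) :
    BB p w x s = ((2 * s) ^ m)⁻¹ * ∫ z, hh p (‖z - x‖ ^ 2 / 2 / s) * w z := by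
  unfold BB AA
  set r := √(2 * s) with hr
  have hr0 : 0 < r := by positivity
  have h1 := Measure.integral_comp_smul (volume : Measure (EE (2 * m)))
    (fun z => ph p (r⁻¹ • z) * w (x + z)) r
  have e1 : ∀ y : EE (2 * m), r⁻¹ • r • y = y := fun y => inv_smul_smul₀ hr0.ne' y
  simp only [e1, finrank_euclideanSpace, Fintype.card_fin] at h1
  rw [h1, abs_of_nonneg (by positivity), pow_mul, hr, Real.sq_sqrt (by positivity), smul_eq_mul]
  congr 1
  rw [← hr, ← integral_sub_right_eq_self _ x]
  congr 1
  ext z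
  rw [add_sub_cancel, hr, ph_scale p _ hs]

lemma BB_abs_bound {n : ℕ} (p : ℕ) (hp : 1 ≤ p) (w : EE n → ℝ) (hw : Continuous w) (x : EE n)
    (A : ℝ) : ∃ C : ℝ, 0 ≤ C ∧ ∀ s, s ≤ A → |BB p (fun z => |w z|) x s| ≤ C := by
  obtain ⟨C, hC⟩ := (isCompact_closedBall x (√(2 * A))).exists_bound_of_continuousOn
    (f := w) hw.continuousOn
  refine ⟨|∫ y : EE n, ph p y * C|, abs_nonneg _, ?_⟩
  intro s hs
  have hnn : 0 ≤ BB p (fun z => |w z|) x s := by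
    apply integral_nonneg
    intro y
    exact mul_nonneg (ph_nonneg p y) (abs_nonneg _)
  rw [abs_of_nonneg hnn]
  refine le_trans ?_ (le_abs_self _)
  apply integral_mono
  · exact ph_mul_integrable hp (by fun_prop)
  · exact ph_mul_integrable hp (by fun_prop)
  · intro y
    simp only
    rcases le_total 1 ‖y‖ with h | h
    · rw [ph_eq_zero hp h]; simp
    · apply mul_le_mul_of_nonneg_left _ (ph_nonneg p y)
      apply hC
      rw [mem_closedBall, dist_eq_norm, add_sub_cancel_left, norm_smul,
        Real.norm_of_nonneg (Real.sqrt_nonneg _)]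
      calc √(2 * s) * ‖y‖ ≤ √(2 * s) * 1 := by gcongr
        _ ≤ √(2 * A) := by rw [mul_one]; gcongr

/-- The integrand of the representation formula. -/
noncomputable def GG {n : ℕ} (M p : ℕ) (T : ℝ) (w : EE n → ℝ) (x : EE n) (s : ℝ) (z : EE n) : ℝ :=
  chi M T s * (s⁻¹ * hh p (‖z - x‖ ^ 2 / 2 / s)) * w z

lemma hh_w_integrable {n : ℕ} (p : ℕ) {w : EE n → ℝ}
    (hwi : Integrable w) (x : EE n) {s : ℝ} (hs : 0 < s) :
    Integrable (fun z => hh p (‖z - x‖ ^ 2 / 2 / s) * w z) := by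
  refine hwi.bdd_mul (c := 1) ?_ ?_
  · have := hh_continuous p
    exact Continuous.aestronglyMeasurable (by fun_prop)
  · filter_upwards with z
    rw [Real.norm_of_nonneg (hh_nonneg _ _)]
    exact hh_le_one p (by positivity)

lemma GG_integrable {m : ℕ} (hm : 2 ≤ m) (p : ℕ) (hp : 1 ≤ p) (T : ℝ) (hT : 0 < T)
    {w : EE (2 * m) → ℝ} (hw : Continuous w) (hwi : Integrable w) (x : EE (2 * m)) :
    Integrable (Function.uncurry (GG m p T w x))
      ((volume.restrict (Set.Ioi (0 : ℝ))).prod volume) := by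
  have hmeas : Measurable (Function.uncurry (GG m p T w x)) := by
    have h1 := (hh_continuous p).measurable
    have h2 := chi_measurable m T
    have h3 := hw.measurable
    unfold GG Function.uncurry
    fun_prop
  rw [integrable_prod_iff hmeas.aestronglyMeasurable]
  constructor
  · filter_upwards [ae_restrict_mem measurableSet_Ioi] with s hs
    have := (hh_w_integrable p hwi x hs).const_mul (chi m T s * s⁻¹)
    refine this.congr (Filter.Eventually.of_forall fun z => ?_)
    simp only [GG, Function.uncurry]
    ring
  · obtain ⟨C, hC0, hC⟩ := BB_abs_bound p hp w hw x (m * T)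
    obtain ⟨C', hC'0, hC'⟩ := chi_bound m hm
    have hb : ∀ s, 0 < s → s ≤ m * T → s ^ m * s⁻¹ ≤ (m * T) ^ (m - 1) := by
      intro s hs hs2
      have : s ^ m * s⁻¹ = s ^ (m - 1) := by
        conv_lhs => rw [show m = m - 1 + 1 by omega, pow_succ]
        field_simp
      rw [this]
      gcongr
    have hval : ∀ s, 0 < s → ∫ z, ‖Function.uncurry (GG m p T w x) (s, z)‖ =
        |chi m T s| * s⁻¹ * ((2 * s) ^ m * BB p (fun z => |w z|) x s) := by
      intro s hs
      rw [BB_eq p _ x hs, mul_inv_cancel_left₀ (by positivity), ← integral_const_mul]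
      congr 1
      ext z
      simp only [GG, Function.uncurry, norm_mul, Real.norm_eq_abs]
      rw [abs_of_nonneg (hh_nonneg _ _), abs_of_nonneg (by positivity : 0 ≤ s⁻¹)]
      ring
    have h5 : IntegrableOn (fun s => ∫ z, ‖Function.uncurry (GG m p T w x) (s, z)‖)
        (Set.Ioc 0 (m * T)) := by
      have hconst : IntegrableOn (fun _ : ℝ => C' * (2 ^ m * (m * T) ^ (m - 1) * C))
        (Set.Ioc 0 (m * T)) :=
        (continuous_const.integrableOn_Icc).mono_set Set.Ioc_subset_Icc_self
      refine Integrable.mono' hconst ?_ ?_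
      · have h6 : AEStronglyMeasurable (fun q : ℝ × EE (2 * m) =>
            ‖Function.uncurry (GG m p T w x) q‖)
            ((volume.restrict (Set.Ioc 0 (m * T))).prod volume) :=
          hmeas.norm.aestronglyMeasurable
        exact h6.integral_prod_right'
      · filter_upwards [ae_restrict_mem measurableSet_Ioc] with s hs
        rw [hval s hs.1, norm_mul, norm_mul, norm_mul, norm_inv, Real.norm_of_nonneg hs.1.le,
          Real.norm_eq_abs, abs_abs, Real.norm_eq_abs, Real.norm_eq_abs,
          abs_of_nonneg (by have := hs.1; positivity : 0 ≤ (2 * s) ^ m)]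
        have hs0 := hs.1
        calc |chi m T s| * s⁻¹ * ((2 * s) ^ m * |BB p (fun z => |w z|) x s|)
            = |chi m T s| * (2 ^ m * (s ^ m * s⁻¹) * |BB p (fun z => |w z|) x s|) := by
              rw [mul_pow]; ring
          _ ≤ _ := by
              gcongr
              · exact hC' T s hT hs0
              · exact hb s hs0 hs.2
              · exact hC s hs.2
    refine IntegrableOn.of_forall_sdiff_eq_zero h5 measurableSet_Ioi ?_
    intro s hs
    have : m * T ≤ s := by
      by_contra h
      exact hs.2 ⟨hs.1, (not_le.1 h).le⟩
    simp only [GG, Function.uncurry, chi, bb_eq_zero m hm T s hT this]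
    simp

noncomputable def K0 (k m : ℕ) : ℝ := cc k m * ((-1) ^ m / (Nat.factorial (m - 1)) / 2 ^ m)

lemma repr_formula {m : ℕ} (hm : 2 ≤ m) (k : ℕ) (hk : 1 ≤ k) (T : ℝ) (hT : 0 < T)
    {u : EE (2 * m) → ℝ} (hu : ContDiff ℝ (⊤ : ℕ∞) u)
    (hwi : Integrable (laplacian^[m] u)) (x : EE (2 * m)) :
    (∫ y : EE (2 * m), ph k y) * u x +
      ∑ i ∈ Finset.range m, (-1 : ℝ) ^ (i + 1) * (m.choose (i + 1)) * BB k u x ((i + 1 : ℕ) * T) =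
    K0 k m * ∫ z, ∫ s in Set.Ioi (0 : ℝ), GG m (k + m) T (laplacian^[m] u) x s z := by
  have h1 := alt_sum (FF k u x) (FF_continuous k hk hu x) (FF_hasDerivAt k hk hu x) m hm T hT
  rw [Finset.sum_range_succ'] at h1
  have e0 : ∀ t, FF k u x 0 t = BB k u x t := by intro t; simp [FF, cc]
  simp only [e0] at h1
  have e1 : BB k u x (((0 : ℕ) : ℝ) * T) = (∫ y : EE (2 * m), ph k y) * u x := by
    unfold BB AA
    simp [integral_mul_const]
  rw [e1] at h1
  simp only [pow_zero, Nat.choose_zero_right, Nat.cast_one, one_mul] at h1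
  rw [add_comm, h1]
  rw [← integral_integral_swap (GG_integrable hm (k + m) (by omega) T hT
    (lap_iter_contDiff hu m).continuous hwi x), ← integral_const_mul]
  apply setIntegral_congr_fun measurableSet_Ioi
  intro s hs
  have hs0 : 0 < s := hs
  simp only [FF, GG]
  rw [BB_eq _ _ x hs0]
  have e2 : ∀ z : EE (2 * m), chi m T s * (s⁻¹ * hh (k + m) (‖z - x‖ ^ 2 / 2 / s)) *
      (laplacian^[m] u) z = chi m T s * s⁻¹ * (hh (k + m) (‖z - x‖ ^ 2 / 2 / s) *
      (laplacian^[m] u) z) := by intro z; ring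
  simp only [e2]
  rw [integral_const_mul]
  unfold K0 chi
  have e3 : s ^ m = s ^ (m - 1) * s := by
    conv_lhs => rw [show m = m - 1 + 1 by omega, pow_succ]
  have e4 : ((-1 : ℝ) ^ m) * (-1) ^ m = 1 := by rw [← mul_pow]; simp
  rw [mul_pow, e3]
  have : (Nat.factorial (m - 1) : ℝ) ≠ 0 := by positivity
  generalize (∫ z, hh (k + m) (‖z - x‖ ^ 2 / 2 / s) * (laplacian^[m] u) z) = J
  field_simp
  have e5 : ((-1 : ℝ)) ^ (m * 2) = 1 := by rw [mul_comm, pow_mul]; simp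
  have e6 : ((-1 : ℝ)) ^ (2 * m) = 1 := by rw [pow_mul]; simp
  ring_nf
  try rw [e5]
  try rw [e6]
  try ring

lemma repr_diff {m : ℕ} (hm : 2 ≤ m) (k : ℕ) (hk : 1 ≤ k)
    {u : EE (2 * m) → ℝ} (hu : ContDiff ℝ (⊤ : ℕ∞) u)
    (hwi : Integrable (laplacian^[m] u)) (x : EE (2 * m)) :
    ∃ C : ℝ, ∀ T : ℝ, 0 < T →
    |(∫ y : EE (2 * m), ph k y) * (u x - u 0) +
      (∑ i ∈ Finset.range m, (-1 : ℝ) ^ (i + 1) * (m.choose (i + 1)) *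
        (BB k u x ((i + 1 : ℕ) * T) - BB k u 0 ((i + 1 : ℕ) * T))) +
      2 * K0 k m * ∫ z, log (‖x - z‖ / ‖z‖) * (laplacian^[m] u) z| ≤ C / √T := by
  obtain ⟨C, hC0, hC⟩ := kernel_est (n := 2 * m) m (k + m) hm (by omega)
  set w := laplacian^[m] u with hw
  have hwc : Continuous w := (lap_iter_contDiff hu m).continuous
  refine ⟨|K0 k m| * (C * ‖x‖ * ∫ z, ‖w z‖), ?_⟩
  intro T hT
  have hGx := GG_integrable hm (k + m) (by omega) T hT hwc hwi x
  have hG0 := GG_integrable hm (k + m) (by omega) T hT hwc hwi 0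
  have r1 := repr_formula hm k hk T hT hu hwi x
  have r0 := repr_formula hm k hk T hT hu hwi 0
  rw [← hw] at r1 r0
  set N : EE (2 * m) → ℝ := fun z => ∫ s in Set.Ioi (0 : ℝ), chi m T s *
    (s⁻¹ * (hh (k + m) (‖z - x‖ ^ 2 / 2 / s) - hh (k + m) (‖z‖ ^ 2 / 2 / s))) with hN
  have hi1 : Integrable (fun z => ∫ s in Set.Ioi (0 : ℝ), GG m (k + m) T w x s z) :=
    hGx.integral_prod_right
  have hi0 : Integrable (fun z => ∫ s in Set.Ioi (0 : ℝ), GG m (k + m) T w 0 s z) :=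
    hG0.integral_prod_right
  have hae : (fun z => (∫ s in Set.Ioi (0 : ℝ), GG m (k + m) T w x s z) -
      ∫ s in Set.Ioi (0 : ℝ), GG m (k + m) T w 0 s z) =ᵐ[volume] fun z => N z * w z := by
    filter_upwards [hGx.prod_left_ae, hG0.prod_left_ae] with z h1 h2
    simp only [Function.uncurry] at h1 h2
    rw [← integral_sub h1 h2, hN]
    simp only
    rw [← integral_mul_const]
    congr 1
    ext s
    simp only [GG, sub_zero]
    ring
  have hNi : Integrable (fun z => N z * w z) := (hi1.sub hi0).congr hae
  have hNint : (∫ z, ∫ s in Set.Ioi (0 : ℝ), GG m (k + m) T w x s z) -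
      (∫ z, ∫ s in Set.Ioi (0 : ℝ), GG m (k + m) T w 0 s z) = ∫ z, N z * w z := by
    rw [← integral_sub hi1 hi0]
    exact integral_congr_ae hae
  have hnt : Nontrivial (EE (2 * m)) := by
    have : Nonempty (Fin (2 * m)) := ⟨⟨0, by omega⟩⟩
    infer_instance
  have hne : ∀ a : EE (2 * m), ∀ᵐ z : EE (2 * m), z ≠ a := by
    intro a
    simp [ae_iff]
  have hbd : ∀ᵐ z : EE (2 * m), ‖N z * w z + 2 * log (‖x - z‖ / ‖z‖) * w z‖ ≤
      C * ‖x‖ / √T * ‖w z‖ := by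
    filter_upwards [hne 0, hne x] with z hz hzx
    rw [← add_mul, norm_mul]
    gcongr
    exact hC T hT x z hz hzx
  have hlm : Measurable (fun z : EE (2 * m) => 2 * log (‖x - z‖ / ‖z‖) * w z) := by
    have := hwc.measurable
    fun_prop
  have hsum : Integrable (fun z => N z * w z + 2 * log (‖x - z‖ / ‖z‖) * w z) :=
    Integrable.mono' (hwi.norm.const_mul _)
      (hNi.aestronglyMeasurable.add hlm.aestronglyMeasurable) hbd
  have hlog : Integrable (fun z => 2 * log (‖x - z‖ / ‖z‖) * w z) := by
    have := hsum.sub hNi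
    refine this.congr (Filter.Eventually.of_forall fun z => ?_)
    simp
  have e1 : 2 * K0 k m * ∫ z, log (‖x - z‖ / ‖z‖) * w z =
      K0 k m * ∫ z, 2 * log (‖x - z‖ / ‖z‖) * w z := by
    rw [mul_comm 2, mul_assoc, ← integral_const_mul]
    simp only [mul_assoc]
  have e2 : (∫ y : EE (2 * m), ph k y) * (u x - u 0) +
      (∑ i ∈ Finset.range m, (-1 : ℝ) ^ (i + 1) * (m.choose (i + 1)) *
        (BB k u x ((i + 1 : ℕ) * T) - BB k u 0 ((i + 1 : ℕ) * T))) = K0 k m * ∫ z, N z * w z := by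
    rw [← hNint, mul_sub (K0 k m), ← r1, ← r0]
    simp only [mul_sub, Finset.sum_sub_distrib]
    ring
  rw [e2, e1, ← mul_add, ← integral_add hNi hlog, abs_mul]
  rw [mul_div_assoc]
  apply mul_le_mul_of_nonneg_left _ (abs_nonneg _)
  have h9 := norm_integral_le_of_norm_le (hwi.norm.const_mul (C * ‖x‖ / √T)) hbd
  rw [integral_const_mul] at h9
  rw [← Real.norm_eq_abs]
  refine h9.trans (le_of_eq ?_)
  ring

/-! ## The constant -/

lemma JJ_eq (m : ℕ) (hm : 1 ≤ m) (k : ℕ) :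
    ∫ r in (0 : ℝ)..1, r ^ (2 * m - 1) * (1 - r ^ 2) ^ k =
      (Nat.factorial k * Nat.factorial (m - 1) / (2 * Nat.factorial (m + k)) : ℝ) := by
  obtain ⟨m, rfl⟩ : ∃ j, m = j + 1 := ⟨m - 1, by omega⟩
  have e : 2 * (m + 1) - 1 = 2 * m + 1 := by omega
  rw [e, Nat.add_sub_cancel]
  induction k with
  | zero =>
    simp only [pow_zero, mul_one, integral_pow, Nat.factorial]
    push_cast
    have : (Nat.factorial m : ℝ) ≠ 0 := by positivity
    field_simp
    simp
    ring
  | succ k ih =>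
    have h1 : ∫ r in (0 : ℝ)..1, ((2 * (m + 1 : ℝ)) * (r ^ (2 * m + 1) * (1 - r ^ 2) ^ (k + 1)) -
        (2 * (k + 1 : ℝ)) * ((r ^ (2 * m + 1) * (1 - r ^ 2) ^ k) -
          r ^ (2 * m + 1) * (1 - r ^ 2) ^ (k + 1))) =
        (1 : ℝ) ^ (2 * m + 2) * (1 - 1 ^ 2) ^ (k + 1) - 0 ^ (2 * m + 2) * (1 - 0 ^ 2) ^ (k + 1) := by
      apply intervalIntegral.integral_eq_sub_of_hasDerivAt
        (f := fun r : ℝ => r ^ (2 * m + 2) * (1 - r ^ 2) ^ (k + 1))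
      · intro r _
        have a1 := hasDerivAt_pow (2 * m + 2) r
        have a2 := ((hasDerivAt_pow 2 r).const_sub 1).pow (k + 1)
        refine (a1.mul a2).congr_deriv ?_
        simp
        ring
      · apply Continuous.intervalIntegrable
        fun_prop
    rw [intervalIntegral.integral_sub, intervalIntegral.integral_const_mul,
      intervalIntegral.integral_const_mul, intervalIntegral.integral_sub, ih] at h1
    · generalize (∫ r in (0 : ℝ)..1, r ^ (2 * m + 1) * (1 - r ^ 2) ^ (k + 1)) = X at *
      have f1 : (Nat.factorial (m + 1 + (k + 1)) : ℝ) = (m + k + 2) * Nat.factorial (m + 1 + k) := by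
        rw [show m + 1 + (k + 1) = (m + 1 + k) + 1 by ring, Nat.factorial_succ]
        push_cast; ring
      have f2 : (Nat.factorial (k + 1) : ℝ) = (k + 1) * Nat.factorial k := by
        rw [Nat.factorial_succ]; push_cast; ring
      rw [f1, f2]
      have : (Nat.factorial (m + 1 + k) : ℝ) ≠ 0 := by positivity
      have p : (m + k + 2 : ℝ) ≠ 0 := by positivity
      field_simp
      field_simp at h1
      simp at h1
      linear_combination h1 
    all_goals
      apply Continuous.intervalIntegrable
      fun_prop

lemma II_eq (m : ℕ) (hm : 1 ≤ m) (k : ℕ) (hk : 1 ≤ k) :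
    ∫ y : EE (2 * m), ph k y = π ^ m * Nat.factorial k / Nat.factorial (m + k) := by
  have hnt : Nontrivial (EE (2 * m)) := by
    have : Nonempty (Fin (2 * m)) := ⟨⟨0, by omega⟩⟩
    infer_instance
  have h1 := integral_fun_norm_addHaar (volume : Measure (EE (2 * m)))
    (fun r : ℝ => (max 0 (1 - r ^ 2)) ^ k)
  unfold ph
  rw [h1, measureReal_def, InnerProductSpace.volume_ball_of_dim_even (k := m) (by simp)]
  have h2 : ∫ y in Set.Ioi (0 : ℝ), y ^ (Module.finrank ℝ (EE (2 * m)) - 1) •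
      (max 0 (1 - y ^ 2)) ^ k = ∫ r in (0 : ℝ)..1, r ^ (2 * m - 1) * (1 - r ^ 2) ^ k := by
    rw [intervalIntegral.integral_of_le zero_le_one]
    have : Set.Ioc (0 : ℝ) 1 ⊆ Set.Ioi 0 := fun x hx => hx.1
    rw [setIntegral_eq_of_subset_of_forall_sdiff_eq_zero measurableSet_Ioi this]
    · apply setIntegral_congr_fun measurableSet_Ioc
      intro r hr
      have : r ^ 2 ≤ 1 := pow_le_one₀ hr.1.le hr.2
      simp only [smul_eq_mul]
      rw [max_eq_right (by linarith)]
      simp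
    · intro r hr
      have hr1 : 1 < r := by
        by_contra h
        exact hr.2 ⟨hr.1, not_lt.1 h⟩
      rw [max_eq_left (by nlinarith), zero_pow (by omega)]
      simp
  rw [h2, JJ_eq m hm]
  have f2 : (Nat.factorial m : ℝ) = m * Nat.factorial (m - 1) := by
    rw [← Nat.mul_factorial_pred (by omega)]; push_cast; ring
  have : (Nat.factorial (m - 1) : ℝ) ≠ 0 := by positivity
  have : (m : ℝ) ≠ 0 := by positivity
  have : (Nat.factorial (m + k) : ℝ) ≠ 0 := by positivity
  simp [f2]
  rw [ENNReal.toReal_ofReal (by positivity)]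
  field_simp

lemma II_pos (m : ℕ) (hm : 1 ≤ m) (k : ℕ) (hk : 1 ≤ k) : 0 < ∫ y : EE (2 * m), ph k y := by
  rw [II_eq m hm k hk]; positivity

lemma cc_eq (k m : ℕ) : cc k m = Nat.factorial k / (2 ^ m * Nat.factorial (k + m)) := by
  unfold cc
  induction m with
  | zero => simp; field_simp
  | succ m ih =>
    rw [Finset.prod_range_succ, ih, ← add_assoc, Nat.factorial_succ]
    push_cast
    field_simp
    ring

lemma K0_eq (m : ℕ) (hm : 1 ≤ m) (k : ℕ) (hk : 1 ≤ k) :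
    2 * K0 k m * ((-1) ^ m * 2) = (∫ y : EE (2 * m), ph k y) * (1 / cconst (2 * m)) := by
  rw [II_eq m hm k hk]
  unfold K0 cconst
  rw [cc_eq]
  have e4 : ((-1 : ℝ) ^ m) * (-1) ^ m = 1 := by rw [← mul_pow]; simp
  have e1 : (2 * m - 2) / 2 = m - 1 := by omega
  have e2 : 2 * m / 2 = m := by omega
  have e3 : (2 : ℝ) ^ (2 * m - 2) * 4 = 2 ^ m * 2 ^ m := by
    rw [show (4 : ℝ) = 2 ^ 2 by norm_num, ← pow_add, ← pow_add]
    congr 1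
    omega
  rw [e1, e2, add_comm m k]
  have : (Nat.factorial (m - 1) : ℝ) ≠ 0 := by positivity
  have : (Nat.factorial (k + m) : ℝ) ≠ 0 := by positivity
  have e5 : (2 : ℝ) ^ (2 * m - 2) = 2 ^ m * 2 ^ m / 4 := by linarith
  rw [e5]
  have e6 : 2 * (Nat.factorial k / (2 ^ m * Nat.factorial (k + m)) *
      ((-1) ^ m / Nat.factorial (m - 1) / 2 ^ m)) * ((-1 : ℝ) ^ m * 2) =
      (((-1 : ℝ) ^ m) * (-1) ^ m) * (4 * (Nat.factorial k / (2 ^ m * Nat.factorial (k + m)) *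
      (1 / Nat.factorial (m - 1) / 2 ^ m))) := by ring
  rw [e6, e4]
  have := Real.pi_pos
  field_simp

lemma laplacian_smul {n : ℕ} (c : ℝ) {g : EE n → ℝ} (hg : ContDiff ℝ (⊤ : ℕ∞) g) (x : EE n) :
    laplacian (fun y => c * g y) x = c * laplacian g x := by
  have : (fun y => c * g y) = c • g := by ext; simp
  unfold laplacian
  rw [this, iteratedFDeriv_const_smul_apply, Finset.mul_sum]
  · simp
  · exact (contDiff_infty.1 hg 2).contDiffAt

lemma negLapIter_eq {n : ℕ} (m : ℕ) {u : EE n → ℝ} (hu : ContDiff ℝ (⊤ : ℕ∞) u) :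
    negLapIter m u = fun x => (-1) ^ m * (laplacian^[m] u) x := by
  induction m with
  | zero => ext; simp [negLapIter]
  | succ m ih =>
    unfold negLapIter at *
    rw [Function.iterate_succ_apply', ih]
    ext x
    rw [laplacian_smul _ (lap_iter_contDiff hu m), Function.iterate_succ_apply']
    ring

/-! ## Growth of the means and of `u` in `L¹` -/

lemma FF_decay {m : ℕ} (hm : 2 ≤ m) (k : ℕ) (hk : 1 ≤ k)
    {u : EE (2 * m) → ℝ} (hu : ContDiff ℝ (⊤ : ℕ∞) u)
    (hwi : Integrable (laplacian^[m] u)) :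
    ∃ D : ℝ, 0 ≤ D ∧ ∀ s, 0 ≤ s → |FF k u 0 m s| ≤ D * (1 / (1 + s ^ 2)) := by
  obtain ⟨D₁, hD₁⟩ := (isCompact_Icc (a := (0 : ℝ)) (b := 1)).exists_bound_of_continuousOn
    (f := fun s => FF k u 0 m s * (1 + s ^ 2))
    ((FF_continuous k hk hu 0 m).mul (by fun_prop)).continuousOn
  set w := laplacian^[m] u with hw
  refine ⟨max D₁ (2 * |cc k m| * ∫ z, |w z|), ?_, ?_⟩
  · refine le_max_of_le_right ?_
    have : 0 ≤ ∫ z, |w z| := integral_nonneg fun z => abs_nonneg _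
    positivity
  intro s hs
  rw [mul_one_div, le_div_iff₀ (by positivity)]
  rcases le_total s 1 with h | h
  · refine le_max_of_le_left ?_
    have := hD₁ s ⟨hs, h⟩
    rwa [norm_mul, Real.norm_eq_abs, Real.norm_of_nonneg (by positivity)] at this
  · refine le_max_of_le_right ?_
    have hs0 : 0 < s := by linarith
    have h0 : 0 ≤ ∫ z, |w z| := integral_nonneg fun z => abs_nonneg _
    have h1 : |∫ z, hh (k + m) (‖z - 0‖ ^ 2 / 2 / s) * w z| ≤ ∫ z, |w z| := by
      rw [← Real.norm_eq_abs]
      refine (norm_integral_le_integral_norm _).trans ?_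
      refine integral_mono (hh_w_integrable _ hwi 0 hs0).norm hwi.norm ?_
      intro z
      simp only [norm_mul, Real.norm_eq_abs]
      rw [abs_of_nonneg (hh_nonneg _ _)]
      exact mul_le_of_le_one_left (abs_nonneg _) (hh_le_one _ (by positivity))
    unfold FF
    rw [BB_eq _ _ _ hs0, abs_mul, abs_mul, abs_of_nonneg (by positivity : 0 ≤ ((2 * s) ^ m)⁻¹)]
    have h2 : s ^ 2 ≤ (2 * s) ^ m := by
      calc s ^ 2 ≤ (2 * s) ^ 2 := by gcongr; linarith
        _ ≤ (2 * s) ^ m := pow_le_pow_right₀ (by linarith) hm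
    have h3 : ((2 * s) ^ m)⁻¹ * (1 + s ^ 2) ≤ 2 := by
      rw [inv_mul_le_iff₀ (by positivity)]
      nlinarith
    calc |cc k m| * (((2 * s) ^ m)⁻¹ * |∫ z, hh (k + m) (‖z - 0‖ ^ 2 / 2 / s) * w z|) * (1 + s ^ 2)
        = |cc k m| * (((2 * s) ^ m)⁻¹ * (1 + s ^ 2)) *
          |∫ z, hh (k + m) (‖z - 0‖ ^ 2 / 2 / s) * w z| := by ring
      _ ≤ |cc k m| * 2 * ∫ z, |w z| := by gcongr
      _ = _ := by ring

lemma BB_growth {m : ℕ} (hm : 2 ≤ m) (k : ℕ) (hk : 1 ≤ k)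
    {u : EE (2 * m) → ℝ} (hu : ContDiff ℝ (⊤ : ℕ∞) u)
    (hwi : Integrable (laplacian^[m] u)) :
    ∃ C : ℝ, 0 ≤ C ∧ ∀ t, 1 ≤ t → |BB k u 0 t| ≤ C * t ^ (m - 1) := by
  obtain ⟨D, hD0, hD⟩ := FF_decay hm k hk hu hwi
  refine ⟨(∑ j ∈ Finset.range m, |FF k u 0 j 0|) + D * (π / 2), ?_, ?_⟩
  · have : 0 ≤ ∑ j ∈ Finset.range m, |FF k u 0 j 0| := Finset.sum_nonneg fun _ _ => abs_nonneg _
    have := Real.pi_pos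
    positivity
  intro t ht
  have h1 := taylor_gen (FF k u 0) (FF_continuous k hk hu 0) (FF_hasDerivAt k hk hu 0) (m - 1) t
    (by linarith)
  have e0 : FF k u 0 0 t = BB k u 0 t := by simp [FF, cc]
  rw [e0, show m - 1 + 1 = m by omega] at h1
  rw [h1]
  refine (abs_add_le _ _).trans ?_
  rw [add_mul]
  gcongr
  · refine (Finset.abs_sum_le_sum_abs _ _).trans ?_
    rw [Finset.sum_mul]
    apply Finset.sum_le_sum
    intro j hj
    rw [Finset.mem_range] at hj
    rw [abs_div, abs_mul, abs_of_nonneg (by positivity : 0 ≤ t ^ j), Nat.abs_cast]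
    have f1 : (1 : ℝ) ≤ Nat.factorial j := by exact_mod_cast Nat.factorial_pos j
    calc |FF k u 0 j 0| * t ^ j / (Nat.factorial j) ≤ |FF k u 0 j 0| * t ^ j :=
          div_le_self (by positivity) f1
      _ ≤ |FF k u 0 j 0| * t ^ (m - 1) := by
          gcongr ?_ * ?_
          exact pow_le_pow_right₀ ht (by omega)
  · have h2 : ‖∫ s in (0 : ℝ)..t, (t - s) ^ (m - 1) / (Nat.factorial (m - 1)) * FF k u 0 m s‖ ≤
        ∫ s in (0 : ℝ)..t, t ^ (m - 1) * D * (1 / (1 + s ^ 2)) := by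
      apply intervalIntegral.norm_integral_le_of_norm_le (by linarith)
      · filter_upwards with s hs
        have hs0 : 0 < s := hs.1
        have f1 : (1 : ℝ) ≤ Nat.factorial (m - 1) := by exact_mod_cast Nat.factorial_pos (m - 1)
        have h4 : 0 ≤ t - s := by linarith [hs.2]
        rw [norm_mul, Real.norm_eq_abs, Real.norm_eq_abs, mul_assoc, abs_of_nonneg (by positivity)]
        have := hD s hs0.le
        gcongr
        refine (div_le_self (by positivity) f1).trans ?_
        gcongr
        linarith
      · apply Continuous.intervalIntegrable
        apply Continuous.mul (by fun_prop)
        apply Continuous.div (by fun_prop) (by fun_prop)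
        intro s
        positivity
    rw [← Real.norm_eq_abs]
    refine h2.trans ?_
    rw [intervalIntegral.integral_const_mul, integral_one_div_one_add_sq, arctan_zero, sub_zero]
    have := (Real.arctan_lt_pi_div_two t).le
    have ht0 : (0 : ℝ) ≤ t := by linarith
    calc t ^ (m - 1) * D * arctan t ≤ t ^ (m - 1) * D * (π / 2) := by gcongr
      _ = _ := by ring

lemma u_growth {m : ℕ} (hm : 2 ≤ m) {u f : EE (2 * m) → ℝ} (hu : ContDiff ℝ (⊤ : ℕ∞) u)
    (hwi : Integrable (laplacian^[m] u)) (hf : Integrable f) (M : ℝ) (hM0 : 0 ≤ M)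
    (hM : ∀ y, max (u y) 0 ≤ |f y| + M + ‖y‖ ^ 2) :
    ∃ C : ℝ, 0 ≤ C ∧ ∀ R : ℝ, 1 ≤ R →
      ∫ y in closedBall (0 : EE (2 * m)) (2 * R), |u y| ≤ C * R ^ (4 * m - 2) := by
  obtain ⟨C, hC0, hC⟩ := BB_growth hm 1 le_rfl hu hwi
  set I : ℝ := ∫ y : EE (2 * m), ph 1 y with hI
  have hI0 : 0 < I := II_pos m (by omega) 1 le_rfl
  set F : ℝ := ∫ y, |f y| with hF
  have hF0 : 0 ≤ F := integral_nonneg fun z => abs_nonneg _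
  refine ⟨4 / 3 * ((2 * F + 2 * (M + 1) * I + C) * 4 ^ (4 * m - 2)), by positivity, ?_⟩
  intro R hR
  set ρ : ℝ := 4 * R with hρ
  have hρ1 : 1 ≤ ρ := by linarith
  have hρ0 : 0 < ρ := by linarith
  set t : ℝ := ρ ^ 2 / 2 with ht
  have ht1 : 1 ≤ t := by nlinarith
  have ht0 : 0 < t := by linarith
  have h2t : (2 * t) ^ m = ρ ^ (2 * m) := by rw [ht, pow_mul]; congr 1; ring
  set g : EE (2 * m) → ℝ := fun z => hh 1 (‖z - 0‖ ^ 2 / 2 / t) with hg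
  have hg0 : ∀ z, 0 ≤ g z := fun z => hh_nonneg _ _
  have hg1 : ∀ z, g z ≤ 1 := fun z => hh_le_one _ (by positivity)
  have hgc : Continuous g := by
    have := hh_continuous 1
    fun_prop
  have hgs : ∀ z, ρ ≤ ‖z‖ → g z = 0 := by
    intro z hz
    simp only [hg, hh, sub_zero, pow_one]
    apply max_eq_left
    rw [sub_nonpos, div_div, one_le_div (by positivity), ht]
    nlinarith
  have hgcomp : HasCompactSupport g := by
    apply HasCompactSupport.intro (isCompact_closedBall (0 : EE (2 * m)) ρ)
    intro y hy
    apply hgs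
    simp at hy
    exact hy.le
  have hgi : ∀ h : EE (2 * m) → ℝ, Continuous h → Integrable (fun z => g z * h z) := fun h hh' =>
    (hgc.mul hh').integrable_of_hasCompactSupport hgcomp.mul_right
  have huc := hu.continuous
  have i1 : ∫ z, g z * u z = ρ ^ (2 * m) * BB 1 u 0 t := by
    rw [BB_eq _ _ _ ht0, h2t, mul_inv_cancel_left₀ (by positivity)]
  have i2 : ∫ z, g z * 1 = ρ ^ (2 * m) * I := by
    have := BB_eq 1 (fun _ : EE (2 * m) => (1 : ℝ)) 0 ht0
    rw [h2t] at this
    have e : BB 1 (fun _ : EE (2 * m) => (1 : ℝ)) 0 t = I := by simp [BB, AA, hI]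
    rw [e] at this
    rw [this, mul_inv_cancel_left₀ (by positivity)]
  have hfi : Integrable (fun z => 2 * |f z|) := hf.abs.const_mul 2
  have hle : ∀ z, g z * |u z| ≤ 2 * |f z| + 2 * (M + ρ ^ 2) * (g z * 1) - g z * u z := by
    intro z
    have e1 : |u z| = 2 * max (u z) 0 - u z := by
      rcases le_total 0 (u z) with h | h
      · rw [abs_of_nonneg h, max_eq_left h]; ring
      · rw [abs_of_nonpos h, max_eq_right h]; ring
    rw [e1]
    have e2 : g z * max (u z) 0 ≤ |f z| + (M + ρ ^ 2) * g z := by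
      rcases le_total ρ ‖z‖ with h | h
      · rw [hgs z h]; simp
      · calc g z * max (u z) 0 ≤ g z * (|f z| + M + ‖z‖ ^ 2) := by gcongr; exact hg0 z; exact hM z
          _ ≤ g z * (|f z| + M + ρ ^ 2) := by gcongr; exact hg0 z
          _ = g z * |f z| + (M + ρ ^ 2) * g z := by ring
          _ ≤ _ := by
            gcongr
            exact mul_le_of_le_one_left (abs_nonneg _) (hg1 z)
    nlinarith
  have key : ∫ z, g z * |u z| ≤ 2 * F + 2 * (M + ρ ^ 2) * (ρ ^ (2 * m) * I) -
      ρ ^ (2 * m) * BB 1 u 0 t := by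
    have j1 := hgi u huc
    have j2 : Integrable (fun z => 2 * (M + ρ ^ 2) * (g z * 1)) :=
      (hgi (fun _ => 1) continuous_const).const_mul _
    have := integral_mono (hgi _ huc.abs) ((hfi.add j2).sub j1) hle
    refine this.trans (le_of_eq ?_)
    rw [integral_sub' (hfi.add j2) j1, integral_add' hfi j2, integral_const_mul, integral_const_mul,
      i1, i2]
  have low : ∫ y in closedBall (0 : EE (2 * m)) (2 * R), |u y| ≤ 4 / 3 * ∫ z, g z * |u z| := by
    rw [← integral_const_mul]
    have hi := (hgi _ huc.abs).const_mul (4 / 3)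
    refine le_trans ?_ (setIntegral_le_integral (s := closedBall (0 : EE (2 * m)) (2 * R)) hi ?_)
    · refine setIntegral_mono_on (huc.abs.continuousOn.integrableOn_compact
        (isCompact_closedBall _ _)) hi.integrableOn measurableSet_closedBall ?_
      intro z hz
      have hz' : ‖z‖ ≤ 2 * R := by simpa using hz
      have : 3 / 4 ≤ g z := by
        simp only [hg, hh, sub_zero, pow_one]
        refine le_max_of_le_right ?_
        have : ‖z‖ ^ 2 / 2 / t ≤ 1 / 4 := by
          rw [div_div, div_le_iff₀ (by positivity), ht, hρ]
          nlinarith [norm_nonneg z]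
        linarith
      nlinarith [abs_nonneg (u z)]
    · filter_upwards with z
      have := hg0 z
      simp only [Pi.zero_apply]
      positivity
  refine low.trans ?_
  rw [mul_assoc]
  gcongr
  refine key.trans ?_
  have hp : (4 : ℝ) ^ (4 * m - 2) * R ^ (4 * m - 2) = ρ ^ (4 * m - 2) := by rw [← mul_pow]
  rw [mul_assoc (2 * F + 2 * (M + 1) * I + C), hp]
  have b1 : 1 ≤ ρ ^ (4 * m - 2) := one_le_pow₀ hρ1
  have b2 : ρ ^ 2 * ρ ^ (2 * m) ≤ ρ ^ (4 * m - 2) := by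
    rw [← pow_add]; exact pow_le_pow_right₀ hρ1 (by omega)
  have b3 : ρ ^ (2 * m) ≤ ρ ^ (4 * m - 2) := pow_le_pow_right₀ hρ1 (by omega)
  have b4 : ρ ^ (2 * m) * |BB 1 u 0 t| ≤ C * ρ ^ (4 * m - 2) := by
    calc ρ ^ (2 * m) * |BB 1 u 0 t| ≤ ρ ^ (2 * m) * (C * t ^ (m - 1)) := by
          gcongr; exact hC t ht1
      _ ≤ ρ ^ (2 * m) * (C * (ρ ^ 2) ^ (m - 1)) := by
          gcongr
          rw [ht]
          have : 0 ≤ ρ ^ 2 := by positivity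
          linarith
      _ = C * ρ ^ (4 * m - 2) := by
          rw [← pow_mul, show 4 * m - 2 = 2 * m + 2 * (m - 1) by omega, pow_add]; ring
  have b5 : -(ρ ^ (2 * m) * BB 1 u 0 t) ≤ ρ ^ (2 * m) * |BB 1 u 0 t| := by
    have := neg_abs_le (BB 1 u 0 t)
    have h : 0 ≤ ρ ^ (2 * m) := by positivity
    nlinarith
  have b6 : 2 * F ≤ 2 * F * ρ ^ (4 * m - 2) := le_mul_of_one_le_right (by positivity) b1
  have b7 : 2 * (M + ρ ^ 2) * (ρ ^ (2 * m) * I) ≤ 2 * (M + 1) * I * ρ ^ (4 * m - 2) := by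
    have : 2 * (M + ρ ^ 2) * (ρ ^ (2 * m) * I) =
      2 * I * (M * ρ ^ (2 * m) + ρ ^ 2 * ρ ^ (2 * m)) := by ring
    rw [this]
    have : 2 * (M + 1) * I * ρ ^ (4 * m - 2) = 2 * I * (M * ρ ^ (4 * m - 2) + ρ ^ (4 * m - 2)) := by
      ring
    rw [this]
    gcongr
  nlinarith

lemma upos_bound {n : ℕ} (hn : 1 ≤ n) {u Q : EE n → ℝ} (hu : Continuous u)
    (hQ : ∀ δ > (0 : ℝ), ∃ Rδ : ℝ, ∀ x : EE n, Rδ ≤ ‖x‖ → Real.exp (-δ * ‖x‖ ^ 2) ≤ Q x) :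
    ∃ M : ℝ, 0 ≤ M ∧ ∀ y, max (u y) 0 ≤ |Q y * Real.exp (n * u y)| + M + ‖y‖ ^ 2 := by
  obtain ⟨R, hR⟩ := hQ 1 one_pos
  obtain ⟨M, hM⟩ := (isCompact_closedBall (0 : EE n) R).exists_bound_of_continuousOn
    (f := u) hu.continuousOn
  refine ⟨max M 0, le_max_right _ _, ?_⟩
  intro y
  have hM0 := le_max_right M 0
  have hM1 := le_max_left M 0
  have ha := abs_nonneg (Q y * Real.exp (n * u y))
  have hs := sq_nonneg ‖y‖
  rcases le_total R ‖y‖ with h | h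
  · have h1 := hR y h
    apply max_le _ (by linarith)
    rcases le_total (u y) 0 with h0 | h0
    · linarith
    have h2 : Real.exp (n * u y - ‖y‖ ^ 2) ≤ Q y * Real.exp (n * u y) := by
      rw [sub_eq_add_neg, add_comm, Real.exp_add]
      gcongr
      simpa using h1
    have h3 := Real.add_one_le_exp (n * u y - ‖y‖ ^ 2)
    have h4 := le_abs_self (Q y * Real.exp (n * u y))
    have h5 : (1 : ℝ) ≤ n := by exact_mod_cast hn
    nlinarith
  · have := hM y (by simpa using h)
    rw [Real.norm_eq_abs] at this
    have h4 := le_abs_self (u y)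
    exact max_le (by linarith) (by linarith)

/-! ## Polynomial approximation of the means -/

def IsP {n : ℕ} (d : ℕ) (h : EE n → ℝ) : Prop :=
  ∃ p : MvPolynomial (Fin n) ℝ, p.totalDegree ≤ d ∧ ∀ x : EE n, h x = MvPolynomial.eval (fun i => x i) p

lemma IsP.mono {n d e : ℕ} {h : EE n → ℝ} (hp : IsP d h) (hde : d ≤ e) : IsP e h := by
  obtain ⟨p, h1, h2⟩ := hp
  exact ⟨p, h1.trans hde, h2⟩

lemma IsP.const {n : ℕ} (d : ℕ) (c : ℝ) : IsP d (fun _ : EE n => c) :=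
  ⟨MvPolynomial.C c, by simp, by simp⟩

lemma IsP.add {n d : ℕ} {g h : EE n → ℝ} (hg : IsP d g) (hh : IsP d h) :
    IsP d (fun x => g x + h x) := by
  obtain ⟨p, h1, h2⟩ := hg
  obtain ⟨q, h3, h4⟩ := hh
  exact ⟨p + q, (MvPolynomial.totalDegree_add _ _).trans (max_le h1 h3), by simp [h2, h4]⟩

lemma IsP.mul {n d e : ℕ} {g h : EE n → ℝ} (hg : IsP d g) (hh : IsP e h) :
    IsP (d + e) (fun x => g x * h x) := by
  obtain ⟨p, h1, h2⟩ := hg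
  obtain ⟨q, h3, h4⟩ := hh
  exact ⟨p * q, (MvPolynomial.totalDegree_mul _ _).trans (add_le_add h1 h3), by simp [h2, h4]⟩

lemma IsP.const_mul {n d : ℕ} {g : EE n → ℝ} (c : ℝ) (hg : IsP d g) :
    IsP d (fun x => c * g x) := by
  have := (IsP.const 0 c).mul hg
  rwa [zero_add] at this

lemma IsP.sum {n d : ℕ} {ι : Type*} (s : Finset ι) {g : ι → EE n → ℝ} (hg : ∀ i ∈ s, IsP d (g i)) :
    IsP d (fun x => ∑ i ∈ s, g i x) := by
  classical
  induction s using Finset.induction_on with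
  | empty => simpa using IsP.const d 0
  | insert a s ha ih =>
    simp only [Finset.sum_insert ha]
    exact (hg a (by simp)).add (ih fun i hi => hg i (by simp [hi]))

lemma IsP.coord {n : ℕ} (i : Fin n) : IsP 1 (fun x : EE n => x i) :=
  ⟨MvPolynomial.X i, by simp, by simp⟩

lemma IsP.pow {n d : ℕ} {g : EE n → ℝ} (hg : IsP d g) (j : ℕ) : IsP (j * d) (fun x => g x ^ j) := by
  induction j with
  | zero => simpa using IsP.const _ 1
  | succ j ih =>
    simp only [pow_succ, Nat.succ_mul]
    exact ih.mul hg

lemma IsP.normsq {n : ℕ} : IsP 2 (fun x : EE n => ‖x‖ ^ 2) := by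
  simp only [EuclideanSpace.real_norm_sq_eq]
  exact IsP.sum _ fun i _ => (IsP.coord i).pow 2

lemma IsP.integral_inner {n : ℕ} (R : ℝ) (e : ℕ) : ∀ {g : EE n → ℝ}, Continuous g →
    IsP e (fun x => ∫ y in closedBall (0 : EE n) R, g y * (inner ℝ x y) ^ e) := by
  induction e with
  | zero => intro g hg; simpa using IsP.const _ _
  | succ e ih =>
    intro g hg
    have : (fun x => ∫ y in closedBall (0 : EE n) R, g y * (inner ℝ x y) ^ (e + 1)) = fun x : EE n =>
        ∑ i, x i * ∫ y in closedBall (0 : EE n) R, (g y * y i) * (inner ℝ x y) ^ e := by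
      ext x
      simp only [← integral_const_mul]
      rw [← integral_finsetSum]
      · congr 1
        ext y
        have : (inner ℝ x y : ℝ) = ∑ i, x i * y i := by
          simp [PiLp.inner_apply, mul_comm]
        rw [pow_succ]
        conv_lhs => enter [2, 2]; rw [this]
        rw [Finset.mul_sum, Finset.mul_sum]
        apply Finset.sum_congr rfl
        intro i _
        ring
      · intro i _
        apply ContinuousOn.integrableOn_compact (isCompact_closedBall _ _)
        apply Continuous.continuousOn
        fun_prop
    rw [this]
    refine IsP.sum _ fun i _ => ?_
    rw [add_comm e 1]
    exact (IsP.coord i).mul (ih (by fun_prop))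

noncomputable def tr (K : ℕ) (a b1 b2 : ℝ) : ℝ :=
  ∑ i ∈ Finset.range (K + 1), ∑ j ∈ Finset.range (i + 1),
    if i + j < K then (K.choose i * i.choose j : ℝ) * (b2 ^ j * b1 ^ (i - j) * a ^ (K - i)) else 0

noncomputable def NK (K : ℕ) : ℝ :=
  ∑ i ∈ Finset.range (K + 1), ∑ j ∈ Finset.range (i + 1), (K.choose i * i.choose j : ℝ)

lemma tr_err (K : ℕ) (a b1 b2 B R : ℝ) (hR : 1 ≤ R) (hB : 1 ≤ B) (ha : |a| ≤ 1)
    (h1 : |b1| ≤ B / R) (h2 : |b2| ≤ B / R ^ 2) :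
    |(b2 + b1 + a) ^ K - tr K a b1 b2| ≤ NK K * (B / R) ^ K := by
  have hfull : (b2 + b1 + a) ^ K = ∑ i ∈ Finset.range (K + 1), ∑ j ∈ Finset.range (i + 1),
      (K.choose i * i.choose j : ℝ) * (b2 ^ j * b1 ^ (i - j) * a ^ (K - i)) := by
    rw [add_pow]
    apply Finset.sum_congr rfl
    intro i _
    rw [add_pow, Finset.sum_mul, Finset.sum_mul]
    apply Finset.sum_congr rfl
    intro j _
    ring
  rw [hfull]
  unfold tr NK
  rw [← Finset.sum_sub_distrib]
  refine (Finset.abs_sum_le_sum_abs _ _).trans ?_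
  rw [Finset.sum_mul]
  apply Finset.sum_le_sum
  intro i hi
  rw [← Finset.sum_sub_distrib]
  refine (Finset.abs_sum_le_sum_abs _ _).trans ?_
  rw [Finset.sum_mul]
  apply Finset.sum_le_sum
  intro j hj
  rw [Finset.mem_range] at hi hj
  split_ifs with h
  · rw [sub_self, abs_zero]; positivity
  · rw [sub_zero, abs_mul, abs_of_nonneg (by positivity : (0 : ℝ) ≤ K.choose i * i.choose j)]
    gcongr ?_ * ?_
    rw [abs_mul, abs_mul, abs_pow, abs_pow, abs_pow]
    have hR0 : 0 < R := by linarith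
    calc |b2| ^ j * |b1| ^ (i - j) * |a| ^ (K - i)
        ≤ (B / R ^ 2) ^ j * (B / R) ^ (i - j) * 1 := by
          gcongr
          exact pow_le_one₀ (abs_nonneg _) ha
      _ = B ^ i / R ^ (i + j) := by
          rw [mul_one, div_pow, div_pow, div_mul_div_comm, ← pow_add, ← pow_mul, ← pow_add]
          congr 2 <;> omega
      _ ≤ B ^ K / R ^ K := by
          gcongr ?_ / ?_
          · exact pow_le_pow_right₀ hB (by omega)
          · exact pow_le_pow_right₀ hR (by omega)
      _ = (B / R) ^ K := by rw [div_pow]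

lemma max_err (K : ℕ) (hK : 1 ≤ K) (a b β : ℝ) (ha : 0 ≤ a) (hb : |b| ≤ β) :
    |(max 0 (b + a)) ^ K - (b + a) ^ K| ≤ β ^ K := by
  have hβ : 0 ≤ β := (abs_nonneg b).trans hb
  rcases le_total 0 (b + a) with h | h
  · rw [max_eq_right h, sub_self, abs_zero]; positivity
  · rw [max_eq_left h, zero_pow (by omega), zero_sub, abs_neg, abs_pow]
    gcongr
    rw [abs_of_nonpos h]
    have := neg_abs_le b
    linarith

lemma max_err2 (K : ℕ) (a b β : ℝ) (ha : a ≤ 0) (hb : |b| ≤ β) :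
    |(max 0 (b + a)) ^ K| ≤ β ^ K := by
  have hβ : 0 ≤ β := (abs_nonneg b).trans hb
  rw [abs_pow, abs_of_nonneg (le_max_left _ _)]
  gcongr
  apply max_le hβ
  have := le_abs_self b
  linarith

/-- The truncated kernel. -/
noncomputable def LL {n : ℕ} (K : ℕ) (R : ℝ) (x y : EE n) : ℝ :=
  tr K (1 - ‖y‖ ^ 2 / R ^ 2) (2 * inner ℝ x y / R ^ 2) (-‖x‖ ^ 2 / R ^ 2)

lemma LL_continuous {n : ℕ} (K : ℕ) (R : ℝ) (x : EE n) : Continuous (LL K R x) := by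
  unfold LL tr
  refine continuous_finsetSum _ fun i _ => continuous_finsetSum _ fun j _ => ?_
  split_ifs
  · fun_prop
  · fun_prop

lemma LL_err {n : ℕ} (K : ℕ) (hK : 1 ≤ K) (R : ℝ) (hR : 1 ≤ R) (x z : EE n) (hx : ‖x‖ ≤ R) :
    |(max 0 (1 - ‖z - x‖ ^ 2 / R ^ 2)) ^ K -
      (closedBall (0 : EE n) R).indicator (LL K R x) z| ≤
    (closedBall (0 : EE n) (2 * R)).indicator
      (fun _ => (NK K + 1) * ((4 * ‖x‖ + ‖x‖ ^ 2 + 1) / R) ^ K) z := by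
  have hR0 : 0 < R := by linarith
  set B := 4 * ‖x‖ + ‖x‖ ^ 2 + 1 with hB
  have hx0 := norm_nonneg x
  have hz0 := norm_nonneg z
  have hB1 : 1 ≤ B := by nlinarith
  have hN : 0 ≤ NK K := by unfold NK; positivity
  set a := 1 - ‖z‖ ^ 2 / R ^ 2 with ha
  set b1 := 2 * inner ℝ x z / R ^ 2 with hb1
  set b2 := -‖x‖ ^ 2 / R ^ 2 with hb2
  have hq : 1 - ‖z - x‖ ^ 2 / R ^ 2 = b2 + b1 + a := by
    rw [norm_sub_sq_real, real_inner_comm, ha, hb1, hb2]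
    field_simp
    ring
  rw [hq]
  have hab2 : |b2| ≤ B / R ^ 2 := by
    rw [hb2, abs_div, abs_neg, abs_of_nonneg (by positivity : 0 ≤ ‖x‖ ^ 2),
      abs_of_nonneg (by positivity : 0 ≤ R ^ 2)]
    gcongr
    linarith
  rcases le_or_gt ‖z‖ (2 * R) with h2 | h2
  · have h2m : z ∈ closedBall (0 : EE n) (2 * R) := by simpa using h2
    rw [Set.indicator_of_mem h2m]
    have hin : |(inner ℝ x z : ℝ)| ≤ ‖x‖ * (2 * R) :=
      (abs_real_inner_le_norm x z).trans (by gcongr)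
    have hab1' : |b1| ≤ 4 * ‖x‖ / R := by
      rw [hb1, abs_div, abs_mul, abs_of_nonneg (by positivity : 0 ≤ R ^ 2), abs_two,
        div_le_div_iff₀ (by positivity) hR0]
      nlinarith
    have hab1 : |b1| ≤ B / R := hab1'.trans (by gcongr; nlinarith)
    have hab2' : |b2| ≤ ‖x‖ ^ 2 / R := by
      rw [hb2, abs_div, abs_neg, abs_of_nonneg (by positivity : 0 ≤ ‖x‖ ^ 2),
        abs_of_nonneg (by positivity : 0 ≤ R ^ 2)]
      gcongr
      nlinarith
    have hab : |b2 + b1| ≤ B / R := by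
      refine (abs_add_le _ _).trans ((add_le_add hab2' hab1').trans ?_)
      rw [← add_div]
      gcongr
      linarith
    rcases le_or_gt ‖z‖ R with h1 | h1
    · have h1m : z ∈ closedBall (0 : EE n) R := by simpa using h1
      rw [Set.indicator_of_mem h1m]
      have ha0 : 0 ≤ a := by
        rw [ha, sub_nonneg, div_le_one (by positivity)]
        gcongr
      have ha1 : |a| ≤ 1 := by
        rw [abs_of_nonneg ha0, ha]
        have : 0 ≤ ‖z‖ ^ 2 / R ^ 2 := by positivity
        linarith
      have t1 := max_err K hK a (b2 + b1) (B / R) ha0 hab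
      have t2 := tr_err K a b1 b2 B R hR hB1 ha1 hab1 hab2
      have : LL K R x z = tr K a b1 b2 := rfl
      rw [this]
      have e : (max 0 (b2 + b1 + a)) ^ K - tr K a b1 b2 = ((max 0 (b2 + b1 + a)) ^ K -
        (b2 + b1 + a) ^ K) + ((b2 + b1 + a) ^ K - tr K a b1 b2) := by ring
      rw [e]
      refine (abs_add_le _ _).trans ?_
      linarith
    · have h1m : z ∉ closedBall (0 : EE n) R := by simpa using h1
      rw [Set.indicator_of_notMem h1m, sub_zero]
      have ha0 : a ≤ 0 := by
        rw [ha, sub_nonpos, one_le_div (by positivity)]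
        gcongr
      have t1 := max_err2 K a (b2 + b1) (B / R) ha0 hab
      refine t1.trans ?_
      have : 0 ≤ (B / R) ^ K := by positivity
      nlinarith
  · have h2m : z ∉ closedBall (0 : EE n) (2 * R) := by simpa using h2
    have h1m : z ∉ closedBall (0 : EE n) R := by
      intro h
      have : ‖z‖ ≤ R := by simpa using h
      linarith
    rw [Set.indicator_of_notMem h2m, Set.indicator_of_notMem h1m, ← hq]
    have h3 : R ≤ ‖z - x‖ := by
      have := norm_sub_norm_le z x
      linarith
    rw [max_eq_left, zero_pow (by omega)]
    · simp
    · rw [sub_nonpos, one_le_div (by positivity)]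
      gcongr

/-- The polynomial approximating the mean. -/
noncomputable def PP {m : ℕ} (K : ℕ) (u : EE (2 * m) → ℝ) (t : ℝ) (x : EE (2 * m)) : ℝ :=
  ((2 * t) ^ m)⁻¹ * ∫ z in closedBall (0 : EE (2 * m)) √(2 * t), LL K √(2 * t) x z * u z

lemma PP_isP {m : ℕ} (K : ℕ) {u : EE (2 * m) → ℝ} (hu : Continuous u) (t : ℝ) :
    IsP (K - 1) (PP K u t) := by
  unfold PP
  apply IsP.const_mul
  set R := √(2 * t)
  have hE : (fun x : EE (2 * m) => ∫ z in closedBall (0 : EE (2 * m)) R, LL K R x z * u z) =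
    fun x : EE (2 * m) => ∑ i ∈ Finset.range (K + 1), ∑ j ∈ Finset.range (i + 1),
      if i + j < K then ((K.choose i * i.choose j : ℝ) * (-1 / R ^ 2) ^ j * (2 / R ^ 2) ^ (i - j)) *
        ((‖x‖ ^ 2) ^ j * ∫ z in closedBall (0 : EE (2 * m)) R,
          ((1 - ‖z‖ ^ 2 / R ^ 2) ^ (K - i) * u z) * (inner ℝ x z) ^ (i - j)) else 0 := by
    ext x
    have hc : ∀ i j : ℕ, IntegrableOn (fun z => (if i + j < K then
        (K.choose i * i.choose j : ℝ) * ((-‖x‖ ^ 2 / R ^ 2) ^ j *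
        (2 * inner ℝ x z / R ^ 2) ^ (i - j) * (1 - ‖z‖ ^ 2 / R ^ 2) ^ (K - i)) else 0) * u z)
        (closedBall (0 : EE (2 * m)) R) := by
      intro i j
      apply ContinuousOn.integrableOn_compact (isCompact_closedBall _ _)
      apply Continuous.continuousOn
      split_ifs
      · fun_prop
      · fun_prop
    simp only [LL, tr, Finset.sum_mul]
    rw [integral_finsetSum _ fun i _ => integrable_finsetSum _ fun j _ => hc i j]
    apply Finset.sum_congr rfl
    intro i _
    rw [integral_finsetSum _ fun j _ => hc i j]
    apply Finset.sum_congr rfl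
    intro j _
    split_ifs
    · rw [← integral_const_mul, ← integral_const_mul]
      congr 1
      ext z
      rw [show -‖x‖ ^ 2 / R ^ 2 = (-1 / R ^ 2) * ‖x‖ ^ 2 by ring,
        show 2 * inner ℝ x z / R ^ 2 = (2 / R ^ 2) * (inner ℝ x z : ℝ) by ring, mul_pow, mul_pow]
      ring
    · simp
  rw [hE]
  refine IsP.sum _ fun i hi => IsP.sum _ fun j hj => ?_
  rw [Finset.mem_range] at hi hj
  split_ifs with h
  · apply IsP.const_mul
    refine IsP.mono ((IsP.normsq.pow j).mul (IsP.integral_inner R (i - j) (by fun_prop))) ?_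
    omega
  · exact IsP.const _ 0

lemma PP_err {m : ℕ} (hm : 2 ≤ m) {u : EE (2 * m) → ℝ} (hu : Continuous u) (C : ℝ) (hC0 : 0 ≤ C)
    (hC : ∀ R : ℝ, 1 ≤ R → ∫ y in closedBall (0 : EE (2 * m)) (2 * R), |u y| ≤ C * R ^ (4 * m - 2))
    (x : EE (2 * m)) :
    ∃ D : ℝ, 0 ≤ D ∧ ∀ t : ℝ, 1 ≤ √(2 * t) → ‖x‖ ≤ √(2 * t) →
      |BB (2 * m - 1) u x t - PP (2 * m - 1) u t x| ≤ D / √(2 * t) := by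
  set K := 2 * m - 1 with hK
  set B := 4 * ‖x‖ + ‖x‖ ^ 2 + 1 with hB
  have hN : 0 ≤ NK K := by unfold NK; positivity
  refine ⟨(NK K + 1) * B ^ K * C, by positivity, ?_⟩
  intro t hR hx
  set R := √(2 * t) with hRdef
  have hR0 : 0 < R := by linarith
  have ht0 : 0 < 2 * t := Real.sqrt_pos.1 hR0
  have hR2 : R ^ 2 = 2 * t := Real.sq_sqrt ht0.le
  have hRm : (2 * t) ^ m = R ^ (2 * m) := by rw [pow_mul, hR2]
  rw [BB_eq _ _ _ (by linarith : 0 < t)]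
  unfold PP
  rw [← hRdef, ← mul_sub, hRm]
  have e1 : ∀ z : EE (2 * m), hh K (‖z - x‖ ^ 2 / 2 / t) = (max 0 (1 - ‖z - x‖ ^ 2 / R ^ 2)) ^ K := by
    intro z
    unfold hh
    rw [hR2, div_div]
  simp only [e1]
  rw [← integral_indicator measurableSet_closedBall]
  set h1 : EE (2 * m) → ℝ := fun z => (max 0 (1 - ‖z - x‖ ^ 2 / R ^ 2)) ^ K with hh1
  have i1 : Integrable (fun z => h1 z * u z) := by
    apply Continuous.integrable_of_hasCompactSupport
    · fun_prop
    · apply HasCompactSupport.intro (isCompact_closedBall x R)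
      intro z hz
      have hz : R < ‖z - x‖ := by simpa [dist_eq_norm] using hz
      simp only [hh1]
      rw [max_eq_left, zero_pow (by omega), zero_mul]
      rw [sub_nonpos, one_le_div (by positivity)]
      gcongr
  have i2 : Integrable ((closedBall (0 : EE (2 * m)) R).indicator (fun z => LL K R x z * u z)) := by
    rw [integrable_indicator_iff measurableSet_closedBall]
    exact ((LL_continuous K R x).mul hu).continuousOn.integrableOn_compact (isCompact_closedBall _ _)
  have i3 : Integrable ((closedBall (0 : EE (2 * m)) (2 * R)).indicator
      (fun z => (NK K + 1) * (B / R) ^ K * |u z|)) := by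
    rw [integrable_indicator_iff measurableSet_closedBall]
    exact (hu.abs.const_mul _).continuousOn.integrableOn_compact (isCompact_closedBall _ _)
  have hb : |∫ z, (h1 z * u z - (closedBall (0 : EE (2 * m)) R).indicator
      (fun z => LL K R x z * u z) z)| ≤ (NK K + 1) * (B / R) ^ K * (C * R ^ (4 * m - 2)) := by
    rw [← Real.norm_eq_abs]
    refine (norm_integral_le_integral_norm _).trans ?_
    refine (integral_mono (i1.sub i2).norm i3 ?_).trans ?_
    · intro z
      have := LL_err K (by omega) R hR x z hx
      have e : h1 z * u z - (closedBall (0 : EE (2 * m)) R).indicator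
        (fun z => LL K R x z * u z) z =
        (h1 z - (closedBall (0 : EE (2 * m)) R).indicator (LL K R x) z) * u z := by
        by_cases hz : z ∈ closedBall (0 : EE (2 * m)) R
        · simp only [Set.indicator_of_mem hz]; ring
        · simp only [Set.indicator_of_notMem hz]; ring
      simp only [Pi.sub_apply]
      rw [e, norm_mul, Real.norm_eq_abs, Real.norm_eq_abs]
      refine (mul_le_mul_of_nonneg_right this (abs_nonneg _)).trans (le_of_eq ?_)
      by_cases hz : z ∈ closedBall (0 : EE (2 * m)) (2 * R)
      · simp only [Set.indicator_of_mem hz]; rfl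
      · simp only [Set.indicator_of_notMem hz]; ring
    · rw [integral_indicator measurableSet_closedBall, integral_const_mul]
      gcongr
      exact hC R hR
  rw [integral_sub i1 i2] at hb
  rw [abs_mul, abs_of_nonneg (by positivity : 0 ≤ (R ^ (2 * m))⁻¹)]
  refine (mul_le_mul_of_nonneg_left hb (by positivity)).trans (le_of_eq ?_)
  have e3 : R ^ (4 * m - 2) * R = R ^ (2 * m) * R ^ K := by
    rw [← pow_succ, ← pow_add]; congr 1; omega
  rw [div_pow]
  field_simp
  linear_combination B ^ K * C * e3

/-! ## Conclusion -/

lemma IsP_limit {n d : ℕ} (F : ℕ → EE n → ℝ) (hF : ∀ N, IsP d (F N)) (h : EE n → ℝ)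
    (hl : ∀ x, Tendsto (fun N => F N x) atTop (𝓝 (h x))) : IsP d h := by
  set ev : MvPolynomial (Fin n) ℝ →ₗ[ℝ] (EE n → ℝ) :=
    LinearMap.pi fun x : EE n => (MvPolynomial.aeval (fun i => x i)).toLinearMap with hev
  set S := (MvPolynomial.restrictTotalDegree (Fin n) ℝ d).map ev with hS
  have hiff : ∀ g : EE n → ℝ, g ∈ S ↔ IsP d g := by
    intro g
    rw [hS, Submodule.mem_map]
    constructor
    · rintro ⟨p, hp, rfl⟩
      rw [MvPolynomial.mem_restrictTotalDegree] at hp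
      refine ⟨p, hp, fun x => ?_⟩
      simp [hev, MvPolynomial.aeval_eq_eval]
    · rintro ⟨p, hp, he⟩
      refine ⟨p, (MvPolynomial.mem_restrictTotalDegree _ _ _).2 hp, ?_⟩
      ext x
      simp [hev, he x, MvPolynomial.aeval_eq_eval]
  have hfin : FiniteDimensional ℝ S := by
    have : Module.Finite ℝ (MvPolynomial.restrictTotalDegree (Fin n) ℝ d) := inferInstance
    exact Module.Finite.map _ _
  have hcl : IsClosed (S : Set (EE n → ℝ)) := S.closed_of_finiteDimensional
  rw [← hiff]
  exact hcl.mem_of_tendsto (tendsto_pi_nhds.2 hl) (Eventually.of_forall fun N => (hiff _).2 (hF N))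

lemma tendsto_of_bound (g : ℕ → ℝ) (C : ℝ) (c : ℝ) (hc : 0 < c) (N₀ : ℕ)
    (h : ∀ N ≥ N₀, |g N| ≤ C / √(c * (N + 1))) : Tendsto g atTop (𝓝 0) := by
  have h1 : Tendsto (fun N : ℕ => C / √(c * ((N : ℝ) + 1))) atTop (𝓝 0) := by
    apply Tendsto.div_atTop tendsto_const_nhds
    apply Real.tendsto_sqrt_atTop.comp
    apply Tendsto.const_mul_atTop hc
    exact tendsto_atTop_add_const_right _ _ tendsto_natCast_atTop_atTop
  refine squeeze_zero_norm' ?_ h1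
  filter_upwards [eventually_ge_atTop N₀] with N hN using h N hN

lemma final_even {m : ℕ} (hm : 2 ≤ m) {u f : EE (2 * m) → ℝ} (hu : ContDiff ℝ (⊤ : ℕ∞) u)
    (hw : ∀ x, (laplacian^[m] u) x = ((-1) ^ m * 2) * f x) (hf : Integrable f)
    (M : ℝ) (hM0 : 0 ≤ M) (hM : ∀ y, max (u y) 0 ≤ |f y| + M + ‖y‖ ^ 2) :
    IsP (2 * m - 2) (fun x => u x + logPot (2 * m) f x) := by
  have hwf : laplacian^[m] u = fun x => ((-1) ^ m * 2) * f x := funext hw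
  have hwi : Integrable (laplacian^[m] u) := by rw [hwf]; exact hf.const_mul _
  obtain ⟨C, hC0, hC⟩ := u_growth hm hu hwi hf M hM0 hM
  have huc := hu.continuous
  set k := 2 * m - 1 with hk
  set I : ℝ := ∫ y : EE (2 * m), ph k y with hI
  have hI0 : 0 < I := II_pos m (by omega) k (by omega)
  set c : ℕ → ℝ := fun i => (-1 : ℝ) ^ (i + 1) * (m.choose (i + 1)) with hc
  set τ : ℕ → ℕ → ℝ := fun i N => ((i + 1 : ℕ) : ℝ) * ((N : ℝ) + 1) with hτ
  apply IsP_limit (fun N x => u 0 + (-(1 / I)) * ∑ i ∈ Finset.range m,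
    c i * (PP k u (τ i N) x + -(BB k u 0 (τ i N))))
  · intro N
    refine (IsP.const _ _).add (IsP.const_mul _ (IsP.sum _ fun i _ => IsP.const_mul _ ?_))
    refine IsP.add ?_ (IsP.const _ _)
    have := PP_isP k huc (τ i N)
    rwa [show k - 1 = 2 * m - 2 by omega] at this
  · intro x
    obtain ⟨D, hD0, hD⟩ := PP_err hm huc C hC0 hC x
    obtain ⟨E, hE⟩ := repr_diff hm k (by omega) hu hwi x
    have hlog : 2 * K0 k m * ∫ z, log (‖x - z‖ / ‖z‖) * (laplacian^[m] u) z =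
        I * logPot (2 * m) f x := by
      have : ∀ z, log (‖x - z‖ / ‖z‖) * (laplacian^[m] u) z =
          ((-1) ^ m * 2) * (log (‖x - z‖ / ‖z‖) * f z) := by
        intro z; rw [hw]; ring
      simp only [this]
      rw [integral_const_mul, ← mul_assoc, K0_eq m (by omega) k (by omega)]
      unfold logPot
      ring
    rw [hlog] at hE
    set A : ℕ → ℝ := fun N => I * (u x - u 0) + (∑ i ∈ Finset.range m, c i *
        (BB k u x (τ i N) - BB k u 0 (τ i N))) + I * logPot (2 * m) f x with hA
    have hA0 : Tendsto A atTop (𝓝 0) := by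
      apply tendsto_of_bound A E 1 one_pos 0
      intro N _
      rw [one_mul]
      exact hE (N + 1) (by positivity)
    have hP0 : ∀ i, Tendsto (fun N => BB k u x (τ i N) - PP k u (τ i N) x) atTop (𝓝 0) := by
      intro i
      obtain ⟨N₀, hN₀⟩ := exists_nat_ge (‖x‖ ^ 2)
      apply tendsto_of_bound _ D (2 * ((i + 1 : ℕ) : ℝ)) (by positivity) N₀
      intro N hN
      have e : 2 * ((i + 1 : ℕ) : ℝ) * ((N : ℝ) + 1) = 2 * τ i N := by simp only [hτ]; ring
      rw [e]
      have hi : (1 : ℝ) ≤ ((i + 1 : ℕ) : ℝ) := by exact_mod_cast Nat.succ_pos i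
      have hN' : (N₀ : ℝ) ≤ N := by exact_mod_cast hN
      have hge : (N : ℝ) + 1 ≤ 2 * τ i N := by
        simp only [hτ]
        nlinarith [(Nat.cast_nonneg N : (0 : ℝ) ≤ N)]
      apply hD
      · rw [Real.one_le_sqrt]
        linarith [(Nat.cast_nonneg N : (0 : ℝ) ≤ N)]
      · apply Real.le_sqrt_of_sq_le
        linarith
    have hS : Tendsto (fun N => ∑ i ∈ Finset.range m, c i *
        (BB k u x (τ i N) - PP k u (τ i N) x)) atTop (𝓝 (∑ i ∈ Finset.range m, c i * 0)) :=
      tendsto_finsetSum _ fun i _ => (hP0 i).const_mul _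
    have hfin := ((hS.sub hA0).const_mul (1 / I)).const_add (u x + logPot (2 * m) f x)
    simp only [mul_zero, Finset.sum_const_zero, sub_zero, add_zero] at hfin
    refine hfin.congr fun N => ?_
    simp only [hA]
    have e1 : ∑ i ∈ Finset.range m, c i * (PP k u (τ i N) x + -(BB k u 0 (τ i N))) =
      (∑ i ∈ Finset.range m, c i * (BB k u x (τ i N) - BB k u 0 (τ i N))) -
      ∑ i ∈ Finset.range m, c i * (BB k u x (τ i N) - PP k u (τ i N) x) := by
      rw [← Finset.sum_sub_distrib]
      apply Finset.sum_congr rfl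
      intro i _
      ring
    rw [e1]
    field_simp
    ring

/-- If `(-Δ)^m u = 2 Q e^{nu}` with `f = Q e^{nu} ∈ L¹` and `Q(x) ≥ e^{-δ|x|²}` near infinity
for every `δ > 0`, then `u + v` is a polynomial of degree at most `n - 2`, where `v` is the
logarithmic potential of `f`. -/
theorem stmt2 (m n : ℕ) (hm : 2 ≤ m) (hn : n = 2 * m)
    (u Q : EuclideanSpace ℝ (Fin n) → ℝ) (hu : ContDiff ℝ (⊤ : ℕ∞) u)
    (hPDE : ∀ x, negLapIter m u x = 2 * Q x * Real.exp (n * u x))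
    (hf : MeasureTheory.Integrable (fun y => Q y * Real.exp (n * u y)))
    (hQ : ∀ δ > (0 : ℝ), ∃ Rδ : ℝ, ∀ x : EuclideanSpace ℝ (Fin n), Rδ ≤ ‖x‖ →
      Real.exp (-δ * ‖x‖ ^ 2) ≤ Q x) :
    ∃ p : MvPolynomial (Fin n) ℝ, p.totalDegree ≤ n - 2 ∧
      ∀ x : EuclideanSpace ℝ (Fin n),
        u x + logPot n (fun y => Q y * Real.exp (n * u y)) x
          = MvPolynomial.eval (fun i => x i) p := by
  subst hn
  have hw : ∀ x, (laplacian^[m] u) x = ((-1) ^ m * 2) * (Q x * Real.exp ((2 * m : ℕ) * u x)) := by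
    intro x
    have h1 := hPDE x
    rw [negLapIter_eq m hu] at h1
    beta_reduce at h1
    have e4 : ((-1 : ℝ) ^ m) * (-1) ^ m = 1 := by rw [← mul_pow]; simp
    calc (laplacian^[m] u) x = (((-1 : ℝ) ^ m) * (-1) ^ m) * (laplacian^[m] u) x := by
          rw [e4, one_mul]
      _ = (-1) ^ m * ((-1) ^ m * (laplacian^[m] u) x) := by ring
      _ = _ := by rw [h1]; ring
  obtain ⟨M, hM0, hM⟩ := upos_bound (by omega) hu.continuous hQ
  exact final_even hm hu hw hf M hM0 hM
end

section
/- Let n = 2m ≥ 4 be an even integer and c_n = 2^{n-2}((n-2)/2)! π^{n/2}. Let u : ℝⁿ → ℝ be smooth with (-Δ)^m u = 2 Q e^{nu}, f := Q e^{nu} ∈ L¹(ℝⁿ), and suppose for every δ > 0 there is R_δ such that Q(x) ≥ e^{-δ|x|²} for |x| ≥ R_δ. Assume ∫₀^∞ e^{u(rθ)} dr = +∞ for every unit vector θ. Let p = u + v be the polynomial of degree at most n-2, where v(x) = (1/c_n)∫_{ℝⁿ} log(|x-y|/|y|) f(y) dy. Then there is no unit vector θ ∈ S^{n-1} and real s >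 0 such that limsup_{r→∞} p(rθ)/r^s < 0. -/
open MeasureTheory Real Filter Metric
open scoped ENNReal Topology

lemma ofReal_integral_le_aux {α : Type*} [MeasurableSpace α] {μ : Measure α} {k : α → ℝ}
    (hk : Integrable k μ) : ENNReal.ofReal (∫ x, k x ∂μ) ≤ ∫⁻ x, ENNReal.ofReal (k x) ∂μ := by
  have h1 : ∫ x, k x ∂μ ≤ ∫ x, max (k x) 0 ∂μ :=
    integral_mono hk hk.pos_part (fun x => le_max_left _ _)
  calc ENNReal.ofReal (∫ x, k x ∂μ) ≤ ENNReal.ofReal (∫ x, max (k x) 0 ∂μ) :=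
        ENNReal.ofReal_le_ofReal h1
    _ = ∫⁻ x, ENNReal.ofReal (max (k x) 0) ∂μ :=
        ofReal_integral_eq_lintegral_ofReal hk.pos_part (ae_of_all _ fun x => le_max_right _ _)
    _ = ∫⁻ x, ENNReal.ofReal (k x) ∂μ := by
        congr 1; ext x; simp [ENNReal.ofReal_max]

lemma jensen_aux {α : Type*} [MeasurableSpace α] {μ : Measure α} {w ψ : α → ℝ}
    (hw0 : 0 ≤ᵐ[μ] w) (hw : Integrable w μ) (hw1 : ∫ x, w x ∂μ ≤ 1)
    (hψ : Integrable (fun x => ψ x * w x) μ) :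
    ENNReal.ofReal (exp (∫ x, ψ x * w x ∂μ))
      ≤ 1 + ∫⁻ x, ENNReal.ofReal (exp (ψ x) * w x) ∂μ := by
  set a := ∫ x, ψ x * w x ∂μ with ha
  set M := ∫ x, w x ∂μ with hM
  have hM0 : 0 ≤ M := integral_nonneg_of_ae hw0
  have hk : Integrable (fun x => exp a * ((1 - a) * w x + ψ x * w x)) μ :=
    ((hw.const_mul _).add hψ).const_mul _
  have hval : ∫ x, exp a * ((1 - a) * w x + ψ x * w x) ∂μ = exp a * ((1 - a) * M + a) := by
    rw [integral_const_mul, integral_add (hw.const_mul _) hψ, integral_const_mul]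
  have h1 : exp a ≤ 1 + exp a * ((1 - a) * M + a) := by
    have h2 : exp a * (1 - a) ≤ 1 := by
      have := Real.add_one_le_exp (-a)
      calc exp a * (1 - a) ≤ exp a * exp (-a) := by gcongr; linarith
        _ = 1 := by rw [← Real.exp_add]; simp
    nlinarith [mul_le_mul_of_nonneg_right h2 (sub_nonneg.2 hw1)]
  calc ENNReal.ofReal (exp a) ≤ ENNReal.ofReal (1 + exp a * ((1 - a) * M + a)) :=
        ENNReal.ofReal_le_ofReal h1
    _ ≤ ENNReal.ofReal 1 + ENNReal.ofReal (exp a * ((1 - a) * M + a)) := ENNReal.ofReal_add_le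
    _ ≤ 1 + ∫⁻ x, ENNReal.ofReal (exp (ψ x) * w x) ∂μ := by
        rw [ENNReal.ofReal_one, ← hval]
        gcongr
        refine (ofReal_integral_le_aux hk).trans ?_
        refine lintegral_mono_ae ?_
        filter_upwards [hw0] with x hx
        apply ENNReal.ofReal_le_ofReal
        have h3 : exp a * (1 - a + ψ x) ≤ exp (ψ x) := by
          have := Real.add_one_le_exp (ψ x - a)
          calc exp a * (1 - a + ψ x) ≤ exp a * exp (ψ x - a) := by gcongr; linarith
            _ = exp (ψ x) := by rw [← Real.exp_add]; simp
        have := mul_le_mul_of_nonneg_right h3 hx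
        linarith

lemma exp_log_aux {E : Type*} [NormedAddCommGroup E] (x y : E) (hx : 1 ≤ ‖x‖) :
    exp (-(1/2) * Real.log (‖x - y‖ / ‖y‖)) ≤ 2 * ‖x‖ * (1 + ‖x - y‖ ^ (-(1/2) : ℝ)) := by
  have ht : 0 ≤ ‖x - y‖ := norm_nonneg _
  have hy : ‖y‖ ≤ ‖x‖ + ‖x - y‖ := by
    have := norm_sub_le x (x - y); simpa using this
  have hp : 0 ≤ ‖x - y‖ ^ (-(1/2) : ℝ) := by positivity
  by_cases h0 : ‖x - y‖ / ‖y‖ = 0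
  · rw [h0]; simp only [Real.log_zero, mul_zero, Real.exp_zero]
    nlinarith
  have hpos : 0 < ‖x - y‖ / ‖y‖ := lt_of_le_of_ne (by positivity) (Ne.symm h0)
  have ht' : 0 < ‖x - y‖ := lt_of_le_of_ne ht (fun h => h0 (by rw [← h]; simp))
  have hy' : 0 < ‖y‖ := lt_of_le_of_ne (norm_nonneg _) (fun h => h0 (by rw [← h]; simp))
  rw [mul_comm, ← Real.rpow_def_of_pos hpos]
  set t := ‖x - y‖
  set r := ‖x‖
  rw [show t / ‖y‖ = (‖y‖ / t)⁻¹ by simp, Real.inv_rpow (by positivity), ← Real.rpow_neg (by positivity)]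
  simp only [neg_neg]
  have hb : ‖y‖ / t ≤ 2 * r * max 1 t⁻¹ := by
    rw [div_le_iff₀ ht']
    rcases le_total 1 t with h | h
    · have : (1:ℝ) ≤ max 1 t⁻¹ := le_max_left _ _
      have h2 : 2 * r * t ≤ 2 * r * max 1 t⁻¹ * t := by
        have : 2 * r * 1 * t ≤ 2 * r * max 1 t⁻¹ * t := by gcongr
        linarith
      nlinarith
    · have : t⁻¹ ≤ max 1 t⁻¹ := le_max_right _ _
      have h2 : 2 * r ≤ 2 * r * max 1 t⁻¹ * t := by
        have : 2 * r * t⁻¹ * t ≤ 2 * r * max 1 t⁻¹ * t := by gcongr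
        rwa [mul_assoc, inv_mul_cancel₀ ht'.ne', mul_one] at this
      nlinarith
  calc (‖y‖ / t) ^ (1/2:ℝ) ≤ (2 * r * max 1 t⁻¹) ^ (1/2:ℝ) := by gcongr
    _ = (2 * r) ^ (1/2:ℝ) * (max 1 t⁻¹) ^ (1/2:ℝ) := Real.mul_rpow (by positivity) (by positivity)
    _ ≤ (2 * r) * (1 + t ^ (-(1/2):ℝ)) := by
      gcongr
      · exact (Real.rpow_le_rpow_of_exponent_le (by linarith) (by norm_num : (1/2:ℝ) ≤ 1)).trans
          (by simp)
      · rcases le_total 1 t⁻¹ with h | h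
        · rw [max_eq_right h, Real.inv_rpow ht, ← Real.rpow_neg ht]; linarith
        · rw [max_eq_left h]; simpa using hp

lemma abs_rpow_aux : ∫⁻ r in Set.Ioc (-1:ℝ) 1, ENNReal.ofReal (|r| ^ (-(1/2):ℝ)) < ⊤ := by
  have h1 : IntervalIntegrable (fun r : ℝ => |r| ^ (-(1/2):ℝ)) volume 0 1 := by
    refine (intervalIntegral.intervalIntegrable_rpow' (r := (-(1/2):ℝ)) (by norm_num)).congr ?_
    intro x hx
    rw [Set.uIoc_of_le zero_le_one] at hx
    simp only [abs_of_pos hx.1]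
  have h2 : IntervalIntegrable (fun r : ℝ => |r| ^ (-(1/2):ℝ)) volume (-1) 0 := by
    have := h1.comp_sub_left 0
    simp at this
    simpa using this.symm
  have h3 := (h2.trans h1)
  rw [intervalIntegrable_iff_integrableOn_Ioc_of_le (by norm_num)] at h3
  rw [← hasFiniteIntegral_iff_ofReal (ae_of_all _ fun x => by positivity)]
  exact h3.2

lemma one_dim_aux : ∃ C : ℝ≥0∞, C < ⊤ ∧ ∀ (R a : ℝ) (t : ℝ → ℝ), 1 ≤ R → (∀ r, |r - a| ≤ t r) →
    ∫⁻ r in Set.Ioi R, ENNReal.ofReal (r ^ (-2:ℝ)) *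
      ENNReal.ofReal (1 + (t r) ^ (-(1/2):ℝ)) ≤ C := by
  refine ⟨(∫⁻ r in Set.Ioi (1:ℝ), ENNReal.ofReal (2 * r ^ (-2:ℝ))) +
    ∫⁻ r in Set.Ioc (-1:ℝ) 1, ENNReal.ofReal (|r| ^ (-(1/2):ℝ)), ?_, ?_⟩
  · refine ENNReal.add_lt_top.2 ⟨?_, abs_rpow_aux⟩
    have := (integrableOn_Ioi_rpow_of_lt (a := -2) (c := 1) (by norm_num) one_pos).const_mul 2
    rw [← hasFiniteIntegral_iff_ofReal]
    · exact this.2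
    · rw [EventuallyLE, ae_restrict_iff' measurableSet_Ioi]
      refine ae_of_all _ fun x hx => ?_
      have : (0:ℝ) < x := lt_trans one_pos hx
      simp only [Pi.zero_apply]; positivity
  · intro R a t hR ht
    have hG : Measurable (Set.indicator (Set.Ioc (-1:ℝ) 1)
        (fun r => ENNReal.ofReal (|r| ^ (-(1/2):ℝ)))) := by
      apply Measurable.indicator _ measurableSet_Ioc
      fun_prop
    calc _ ≤ ∫⁻ r in Set.Ioi R, (ENNReal.ofReal (2 * r ^ (-2:ℝ)) +
          Set.indicator (Set.Ioc (-1:ℝ) 1)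
            (fun r => ENNReal.ofReal (|r| ^ (-(1/2):ℝ))) (r - a)) := by
          apply lintegral_mono_ae
          rw [ae_restrict_iff' measurableSet_Ioi]
          filter_upwards [compl_mem_ae_iff.2 (measure_singleton (μ := volume) a)] with r hra hr
          have hr1 : 1 < r := lt_of_le_of_lt hR hr
          have hra' : 0 < |r - a| := abs_pos.2 (sub_ne_zero.2 hra)
          have ht' := lt_of_lt_of_le hra' (ht r)
          have hq : r ^ (-2:ℝ) ≤ 1 := Real.rpow_le_one_of_one_le_of_nonpos hr1.le (by norm_num)
          have hq0 : 0 < r ^ (-2:ℝ) := by positivity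
          have hm : (t r) ^ (-(1/2):ℝ) ≤ |r - a| ^ (-(1/2):ℝ) :=
            Real.rpow_le_rpow_of_nonpos hra' (ht r) (by norm_num)
          rw [← ENNReal.ofReal_mul hq0.le]
          by_cases hmem : r - a ∈ Set.Ioc (-1:ℝ) 1
          · rw [Set.indicator_of_mem hmem, ← ENNReal.ofReal_add (by positivity) (by positivity)]
            apply ENNReal.ofReal_le_ofReal
            have : 0 < (t r) ^ (-(1/2):ℝ) := by positivity
            nlinarith
          · rw [Set.indicator_of_notMem hmem, add_zero]
            apply ENNReal.ofReal_le_ofReal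
            have h1 : 1 ≤ |r - a| := by
              by_contra hlt
              push Not at hlt
              exact hmem ⟨(abs_lt.1 hlt).1, (abs_lt.1 hlt).2.le⟩
            have : (t r) ^ (-(1/2):ℝ) ≤ 1 :=
              Real.rpow_le_one_of_one_le_of_nonpos (h1.trans (ht r)) (by norm_num)
            nlinarith
      _ = (∫⁻ r in Set.Ioi R, ENNReal.ofReal (2 * r ^ (-2:ℝ))) +
          ∫⁻ r in Set.Ioi R, Set.indicator (Set.Ioc (-1:ℝ) 1)
            (fun r => ENNReal.ofReal (|r| ^ (-(1/2):ℝ))) (r - a) := by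
          rw [lintegral_add_left (by fun_prop)]
      _ ≤ _ := by
          gcongr ?_ + ?_
          · exact lintegral_mono_set (Set.Ioi_subset_Ioi hR)
          · refine (setLIntegral_le_lintegral _ _).trans ?_
            rw [lintegral_sub_right_eq_self (μ := volume) (fun r => Set.indicator (Set.Ioc (-1:ℝ) 1)
            (fun r => ENNReal.ofReal (|r| ^ (-(1/2):ℝ))) r) a, lintegral_indicator measurableSet_Ioc]

lemma pot_aux {E : Type*} [NormedAddCommGroup E] [MeasurableSpace E] [BorelSpace E]
    [SecondCountableTopology E]
    (μ : Measure E) [NullSingletonClass μ] (f : E → ℝ) (hf : Integrable f μ) (c R : ℝ) (hc : 0 < c)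
    (hpos : ∀ y, y ∈ (ball (0:E) R)ᶜ → 0 ≤ f y)
    (hM : ∫ y in (ball (0:E) R)ᶜ, 2 / c * f y ∂μ ≤ 1) :
    ∃ A K : ℝ, ∀ x : E, 1 ≤ ‖x‖ → R + 1 ≤ ‖x‖ →
      ENNReal.ofReal (exp (-((1 / c) * ∫ y, Real.log (‖x - y‖ / ‖y‖) * f y ∂μ))) ≤
      ENNReal.ofReal (exp (A * Real.log (2 * ‖x‖) + K)) *
        (1 + ∫⁻ y in (ball (0:E) R)ᶜ, ENNReal.ofReal (1 + ‖x - y‖ ^ (-(1/2):ℝ)) *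
          ENNReal.ofReal (2 / c * f y) ∂μ) := by
  set L := ∫ y, |f y| ∂μ with hL
  have hL0 : 0 ≤ L := integral_nonneg fun y => abs_nonneg _
  set K0 := ∫ y in ball (0:E) R, Real.log ‖y‖ * f y ∂μ with hK0
  refine ⟨L / c + 1, |K0| / c, fun x hx1 hxR => ?_⟩
  have hlog : 0 ≤ Real.log (2 * ‖x‖) := Real.log_nonneg (by linarith)
  by_cases hint : Integrable (fun y => Real.log (‖x - y‖ / ‖y‖) * f y) μ
  swap
  · rw [integral_undef hint]
    simp only [mul_zero, neg_zero, Real.exp_zero, ENNReal.ofReal_one]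
    have h1 : (1:ℝ≥0∞) ≤ ENNReal.ofReal (exp ((L / c + 1) * Real.log (2 * ‖x‖) + |K0| / c)) := by
      rw [ENNReal.one_le_ofReal]
      exact Real.one_le_exp (by positivity)
    calc (1:ℝ≥0∞) = 1 * 1 := by simp
      _ ≤ _ := mul_le_mul' h1 le_self_add
  have hb : ∀ y ∈ ball (0:E) R, 0 ≤ Real.log ‖x - y‖ ∧ Real.log ‖x - y‖ ≤ Real.log (2 * ‖x‖) := by
    intro y hy
    rw [mem_ball_zero_iff] at hy
    have h1 : 1 ≤ ‖x - y‖ := by have := norm_sub_norm_le x y; linarith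
    have h2 : ‖x - y‖ ≤ 2 * ‖x‖ := by have := norm_sub_le x y; linarith
    exact ⟨Real.log_nonneg h1, Real.log_le_log (by linarith) h2⟩
  have hi1 : IntegrableOn (fun y => Real.log ‖x - y‖ * f y) (ball (0:E) R) μ := by
    refine Integrable.bdd_mul (c := Real.log (2 * ‖x‖)) hf.integrableOn ?_ ?_
    · exact (Real.measurable_log.comp (by fun_prop)).aestronglyMeasurable
    · rw [ae_restrict_iff' measurableSet_ball]
      refine ae_of_all _ fun y hy => ?_
      rw [Real.norm_eq_abs, abs_of_nonneg (hb y hy).1]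
      exact (hb y hy).2
  have hae : ∀ᵐ y ∂(μ.restrict (ball (0:E) R)),
      Real.log (‖x - y‖ / ‖y‖) * f y = Real.log ‖x - y‖ * f y - Real.log ‖y‖ * f y := by
    rw [ae_restrict_iff' measurableSet_ball]
    filter_upwards [compl_mem_ae_iff.2 (measure_singleton (μ := μ) (0:E))] with y hy0 hy
    have hyn : ‖y‖ ≠ 0 := norm_ne_zero_iff.2 hy0
    have hxy : ‖x - y‖ ≠ 0 := by
      rw [mem_ball_zero_iff] at hy
      have := norm_sub_norm_le x y
      intro h; linarith
    rw [Real.log_div hxy hyn, sub_mul]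
  have hi2 : IntegrableOn (fun y => Real.log ‖y‖ * f y) (ball (0:E) R) μ := by
    refine (hi1.sub hint.integrableOn).congr ?_
    filter_upwards [hae] with y hy
    simp only [Pi.sub_apply, hy]; ring
  have hB : -∫ y in ball (0:E) R, Real.log (‖x - y‖ / ‖y‖) * f y ∂μ
      ≤ L * Real.log (2 * ‖x‖) + |K0| := by
    rw [integral_congr_ae hae, integral_sub hi1 hi2]
    have h1 : |∫ y in ball (0:E) R, Real.log ‖x - y‖ * f y ∂μ| ≤ L * Real.log (2 * ‖x‖) := by
      calc |∫ y in ball (0:E) R, Real.log ‖x - y‖ * f y ∂μ|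
          ≤ ∫ y in ball (0:E) R, |Real.log ‖x - y‖ * f y| ∂μ := abs_integral_le_integral_abs
        _ ≤ ∫ y in ball (0:E) R, |f y| * Real.log (2 * ‖x‖) ∂μ := by
            refine setIntegral_mono_on hi1.abs (hf.abs.mul_const _).integrableOn
              measurableSet_ball fun y hy => ?_
            rw [abs_mul, abs_of_nonneg (hb y hy).1, mul_comm]
            exact mul_le_mul_of_nonneg_left (hb y hy).2 (abs_nonneg _)
        _ ≤ ∫ y, |f y| * Real.log (2 * ‖x‖) ∂μ :=
            setIntegral_le_integral (hf.abs.mul_const _) (ae_of_all _ fun y => by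
              simp only [Pi.zero_apply]; positivity)
        _ = L * Real.log (2 * ‖x‖) := by rw [integral_mul_const]
    have h2 := neg_abs_le (∫ y in ball (0:E) R, Real.log ‖x - y‖ * f y ∂μ)
    have h3 := le_abs_self K0
    linarith
  have hsplit := integral_add_compl (measurableSet_ball (x := (0:E)) (ε := R)) hint
  have hS : (fun y => (-(1/2) * Real.log (‖x - y‖ / ‖y‖)) * (2 / c * f y)) =
      fun y => (-(1/c)) * (Real.log (‖x - y‖ / ‖y‖) * f y) := by
    ext y; field_simp
  have hJ := jensen_aux (μ := μ.restrict (ball (0:E) R)ᶜ) (w := fun y => 2 / c * f y)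
    (ψ := fun y => -(1/2) * Real.log (‖x - y‖ / ‖y‖))
    (by
      rw [EventuallyLE, ae_restrict_iff' measurableSet_ball.compl]
      refine ae_of_all _ fun y hy => ?_
      have := hpos y hy
      simp only [Pi.zero_apply]; positivity)
    (hf.const_mul _).integrableOn hM (by
      rw [hS]; exact (hint.const_mul _).integrableOn)
  rw [hS, integral_const_mul] at hJ
  have hexp : exp (-((1 / c) * ∫ y, Real.log (‖x - y‖ / ‖y‖) * f y ∂μ)) ≤
      exp (L / c * Real.log (2 * ‖x‖) + |K0| / c) *
      exp (-(1/c) * ∫ y in (ball (0:E) R)ᶜ, Real.log (‖x - y‖ / ‖y‖) * f y ∂μ) := by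
    rw [← Real.exp_add, Real.exp_le_exp, ← hsplit]
    have h1 := mul_le_mul_of_nonneg_left hB (show 0 ≤ 1 / c by positivity)
    have h2 : 1 / c * (L * Real.log (2 * ‖x‖) + |K0|) =
      L / c * Real.log (2 * ‖x‖) + |K0| / c := by ring
    linarith
  have hfac : exp ((L / c + 1) * Real.log (2 * ‖x‖) + |K0| / c) =
      exp (L / c * Real.log (2 * ‖x‖) + |K0| / c) * (2 * ‖x‖) := by
    rw [show (L / c + 1) * Real.log (2 * ‖x‖) + |K0| / c =
      (L / c * Real.log (2 * ‖x‖) + |K0| / c) + Real.log (2 * ‖x‖) by ring, Real.exp_add,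
      Real.exp_log (by linarith)]
  rw [hfac]
  refine (ENNReal.ofReal_le_ofReal hexp).trans ?_
  rw [ENNReal.ofReal_mul (by positivity), ENNReal.ofReal_mul (by positivity), mul_assoc]
  gcongr
  refine hJ.trans ?_
  rw [mul_add, ← lintegral_const_mul' _ _ ENNReal.ofReal_ne_top]
  gcongr ?_ + ?_
  · rw [mul_one, ENNReal.one_le_ofReal]; linarith
  · refine lintegral_mono fun y => ?_
    simp only
    rw [← mul_assoc (ENNReal.ofReal _), ← ENNReal.ofReal_mul (show 0 ≤ 2 * ‖x‖ by positivity),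
      ENNReal.ofReal_mul (Real.exp_pos _).le]
    exact mul_le_mul' (ENNReal.ofReal_le_ofReal (exp_log_aux x y hx1)) le_rfl

lemma decay_aux (A K ε s : ℝ) (hε : 0 < ε) (hs : 0 < s) :
    ∀ᶠ r : ℝ in atTop, exp (-ε * r ^ s) * exp (A * Real.log (2 * r) + K) ≤ r ^ (-2:ℝ) := by
  have h1 := (isLittleO_log_rpow_atTop hs).const_mul_left (A + 2)
  have h2 : Tendsto (fun r : ℝ => r ^ s) atTop atTop := tendsto_rpow_atTop hs
  filter_upwards [h1.bound (half_pos hε), h2.eventually_ge_atTop ((A * Real.log 2 + K) / (ε/2)),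
    eventually_gt_atTop 1] with r ha hb hr
  have hr0 : 0 < r := by linarith
  rw [← Real.exp_add, Real.rpow_def_of_pos hr0 (-2), Real.exp_le_exp,
    Real.log_mul (by norm_num) hr0.ne']
  rw [div_le_iff₀ (by positivity)] at hb
  rw [Real.norm_eq_abs, Real.norm_eq_abs, abs_of_pos (show 0 < r ^ s by positivity)] at ha
  have := le_abs_self ((A + 2) * Real.log r)
  nlinarith

lemma limsup_aux (g : ℝ → ℝ) (h : limsup g atTop < 0) : ∃ ε > 0, ∀ᶠ r in atTop, g r ≤ -ε := by
  rw [limsup_eq] at h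
  by_cases hne : {a | ∀ᶠ r in atTop, g r ≤ a}.Nonempty
  · obtain ⟨a, ha, ha0⟩ := exists_lt_of_csInf_lt hne h
    exact ⟨-a, by linarith, by simpa using ha⟩
  · rw [Set.not_nonempty_iff_eq_empty.1 hne] at h
    simp at h

lemma tail_aux {E : Type*} [NormedAddCommGroup E] [MeasurableSpace E] [BorelSpace E]
    (μ : Measure E) (f : E → ℝ) (hf : Integrable f μ) (b : ℝ) (hb : 0 < b) :
    ∀ᶠ R : ℝ in atTop, ∫ y in (ball (0:E) R)ᶜ, f y ∂μ ≤ b := by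
  have h := tendsto_setIntegral_of_antitone (μ := μ) (f := f) (s := fun R : ℝ => (ball (0:E) R)ᶜ)
    (fun R => measurableSet_ball.compl)
    (fun a b hab => Set.compl_subset_compl.2 (ball_subset_ball hab)) ⟨0, hf.integrableOn⟩
  have h0 : (⋂ R : ℝ, (ball (0:E) R)ᶜ) = ∅ := by
    ext y
    simp only [Set.mem_iInter, Set.mem_compl_iff, mem_ball_zero_iff, Set.mem_empty_iff_false,
      iff_false, not_forall, not_not]
    exact ⟨‖y‖ + 1, by linarith⟩
  rw [h0] at h
  simp only [setIntegral_empty] at h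
  exact (h.eventually_lt_const hb).mono fun _ h => h.le

/-- Under completeness along rays, the polynomial `p = u + v` cannot satisfy
`limsup p(rθ)/r^s < 0` for any direction `θ` and any real `s > 0`. -/
theorem stmt4 (m n : ℕ) (hm : 2 ≤ m) (hn : n = 2 * m)
    (u Q : EuclideanSpace ℝ (Fin n) → ℝ) (hu : ContDiff ℝ (⊤ : ℕ∞) u)
    (hPDE : ∀ x, negLapIter m u x = 2 * Q x * Real.exp (n * u x))
    (hf : MeasureTheory.Integrable (fun y => Q y * Real.exp (n * u y)))
    (hQ : ∀ δ > (0 : ℝ), ∃ Rδ : ℝ, ∀ x : EuclideanSpace ℝ (Fin n), Rδ ≤ ‖x‖ →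
      Real.exp (-δ * ‖x‖ ^ 2) ≤ Q x)
    (hcomplete : ∀ θ : EuclideanSpace ℝ (Fin n), ‖θ‖ = 1 →
      ∫⁻ r in Set.Ioi (0 : ℝ), ENNReal.ofReal (Real.exp (u (r • θ))) = ⊤)
    (p : MvPolynomial (Fin n) ℝ) (hdeg : p.totalDegree ≤ n - 2)
    (hupv : ∀ x : EuclideanSpace ℝ (Fin n),
      u x + logPot n (fun y => Q y * Real.exp (n * u y)) x
        = MvPolynomial.eval (fun i => x i) p) :
    ¬ ∃ (θ : EuclideanSpace ℝ (Fin n)) (s : ℝ), ‖θ‖ = 1 ∧ 0 < s ∧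
      Filter.limsup (fun r : ℝ => MvPolynomial.eval (fun i => (r • θ) i) p / r ^ s)
        Filter.atTop < 0 := by
  rintro ⟨θ, s, hθ, hs, hlim⟩
  have : NeZero n := ⟨by omega⟩
  set f : EuclideanSpace ℝ (Fin n) → ℝ := fun y => Q y * Real.exp (n * u y) with hfdef
  have hc : 0 < cconst n := by unfold cconst; positivity
  obtain ⟨ε, hε, hlim'⟩ := limsup_aux _ hlim
  obtain ⟨R0, hR0⟩ := hQ 1 one_pos
  obtain ⟨R, hRR0, hRM⟩ := ((eventually_ge_atTop R0).and
    (tail_aux volume (fun y => 2 / cconst n * f y) (hf.const_mul _) 1 one_pos)).exists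
  set S := (ball (0 : EuclideanSpace ℝ (Fin n)) R)ᶜ with hS
  have hpos : ∀ y ∈ S, 0 ≤ f y := by
    intro y hy
    simp only [hS, Set.mem_compl_iff, mem_ball_zero_iff, not_lt] at hy
    have := (Real.exp_pos _).le.trans (hR0 y (hRR0.trans hy))
    simp only [hfdef]; positivity
  obtain ⟨A, K, hAK⟩ := pot_aux volume f hf (cconst n) R hc hpos hRM
  obtain ⟨R1, hR1⟩ := eventually_atTop.1 (hlim'.and (decay_aux A K ε s hε hs))
  set R2 := max R1 (max 1 (R + 1)) with hR2
  have hR2a : R1 ≤ R2 := le_max_left _ _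
  have hR2b : 1 ≤ R2 := (le_max_left _ _).trans (le_max_right _ _)
  have hR2c : R + 1 ≤ R2 := (le_max_right _ _).trans (le_max_right _ _)
  have hbound : ∀ r ∈ Set.Ioi R2, ENNReal.ofReal (Real.exp (u (r • θ))) ≤
      ENNReal.ofReal (r ^ (-2:ℝ)) * (1 + ∫⁻ y in S,
        ENNReal.ofReal (1 + ‖r • θ - y‖ ^ (-(1/2):ℝ)) * ENNReal.ofReal (2 / cconst n * f y)) := by
    intro r hr
    have hr' : R2 < r := hr
    have hr0 : 0 < r := by linarith
    have hnorm : ‖r • θ‖ = r := by rw [norm_smul, hθ, mul_one, Real.norm_of_nonneg hr0.le]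
    obtain ⟨hp1, hp2⟩ := hR1 r (by linarith)
    have h1 := hAK (r • θ) (by rw [hnorm]; linarith) (by rw [hnorm]; linarith)
    rw [hnorm] at h1
    have h2 := hupv (r • θ)
    rw [div_le_iff₀ (by positivity)] at hp1
    have h3 : Real.exp (u (r • θ)) ≤ exp (-ε * r ^ s) * exp (-logPot n f (r • θ)) := by
      rw [← Real.exp_add, Real.exp_le_exp]
      linarith
    refine (ENNReal.ofReal_le_ofReal h3).trans ?_
    rw [ENNReal.ofReal_mul (by positivity)]
    calc _ ≤ ENNReal.ofReal (exp (-ε * r ^ s)) *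
          (ENNReal.ofReal (exp (A * Real.log (2 * r) + K)) * (1 + ∫⁻ y in S,
            ENNReal.ofReal (1 + ‖r • θ - y‖ ^ (-(1/2):ℝ)) *
              ENNReal.ofReal (2 / cconst n * f y))) := by
          gcongr
          exact h1
      _ ≤ _ := by
          rw [← mul_assoc, ← ENNReal.ofReal_mul (by positivity)]
          gcongr
  obtain ⟨C, hC, hCb⟩ := one_dim_aux
  have hfin1 : ∫⁻ r in Set.Ioc 0 R2, ENNReal.ofReal (Real.exp (u (r • θ))) < ⊤ := by
    have hcont : Continuous fun r : ℝ => Real.exp (u (r • θ)) := by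
      have := hu.continuous
      fun_prop
    have := (hcont.integrableOn_Ioc (a := 0) (b := R2) (μ := volume)).2
    rwa [hasFiniteIntegral_iff_ofReal (ae_of_all _ fun x => (Real.exp_pos _).le)] at this
  have hmeas : AEMeasurable (fun y => ENNReal.ofReal (2 / cconst n * f y)) (volume.restrict S) :=
    ((hf.const_mul _).integrableOn.aestronglyMeasurable.aemeasurable).ennreal_ofReal
  have hfin2 : ∫⁻ r in Set.Ioi R2, ENNReal.ofReal (Real.exp (u (r • θ))) < ⊤ := by
    calc _ ≤ ∫⁻ r in Set.Ioi R2, ENNReal.ofReal (r ^ (-2:ℝ)) * (1 + ∫⁻ y in S,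
        ENNReal.ofReal (1 + ‖r • θ - y‖ ^ (-(1/2):ℝ)) * ENNReal.ofReal (2 / cconst n * f y)) :=
          setLIntegral_mono' measurableSet_Ioi hbound
      _ = ∫⁻ r in Set.Ioi R2, (ENNReal.ofReal (r ^ (-2:ℝ)) + ∫⁻ y in S,
          ENNReal.ofReal (r ^ (-2:ℝ)) * (ENNReal.ofReal (1 + ‖r • θ - y‖ ^ (-(1/2):ℝ)) *
            ENNReal.ofReal (2 / cconst n * f y))) := by
          congr 1; ext r
          rw [mul_add, mul_one, lintegral_const_mul' _ _ (by simp)]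
      _ = (∫⁻ r in Set.Ioi R2, ENNReal.ofReal (r ^ (-2:ℝ))) + ∫⁻ r in Set.Ioi R2, ∫⁻ y in S,
          ENNReal.ofReal (r ^ (-2:ℝ)) * (ENNReal.ofReal (1 + ‖r • θ - y‖ ^ (-(1/2):ℝ)) *
            ENNReal.ofReal (2 / cconst n * f y)) := by
          rw [lintegral_add_left (by fun_prop)]
      _ = (∫⁻ r in Set.Ioi R2, ENNReal.ofReal (r ^ (-2:ℝ))) + ∫⁻ y in S, ∫⁻ r in Set.Ioi R2,
          ENNReal.ofReal (r ^ (-2:ℝ)) * (ENNReal.ofReal (1 + ‖r • θ - y‖ ^ (-(1/2):ℝ)) *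
            ENNReal.ofReal (2 / cconst n * f y)) := by
          rw [lintegral_lintegral_swap]
          have hm1 : Measurable fun z : ℝ × EuclideanSpace ℝ (Fin n) =>
              ENNReal.ofReal (z.1 ^ (-2:ℝ)) := by fun_prop
          have hm2 : Measurable fun z : ℝ × EuclideanSpace ℝ (Fin n) =>
              ENNReal.ofReal (1 + ‖z.1 • θ - z.2‖ ^ (-(1/2):ℝ)) := by fun_prop
          exact hm1.aemeasurable.mul (hm2.aemeasurable.mul hmeas.comp_snd)
      _ ≤ C + ∫⁻ y in S, C * ENNReal.ofReal (2 / cconst n * f y) := by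
          gcongr with y
          · refine le_trans ?_ (hCb R2 0 (fun r => |r - 0|) hR2b fun r => le_rfl)
            gcongr with r
            refine le_mul_of_one_le_right' ?_
            rw [ENNReal.one_le_ofReal]
            have : 0 ≤ |r - 0| ^ (-(1/2):ℝ) := by positivity
            linarith
          · simp_rw [← mul_assoc]
            rw [lintegral_mul_const' _ _ (by simp)]
            gcongr
            refine hCb R2 (inner ℝ θ y) (fun r => ‖r • θ - y‖) hR2b fun r => ?_
            have h1 := abs_real_inner_le_norm θ (r • θ - y)
            rw [inner_sub_right, inner_smul_right, real_inner_self_eq_norm_sq, hθ] at h1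
            simpa using h1
      _ < ⊤ := by
          rw [lintegral_const_mul' _ _ hC.ne]
          refine ENNReal.add_lt_top.2 ⟨hC, ENNReal.mul_lt_top hC ?_⟩
          have h1 : Integrable (fun y => 2 / cconst n * f y) (volume.restrict S) :=
            (hf.const_mul _).integrableOn
          have := h1.2
          rwa [hasFiniteIntegral_iff_ofReal] at this
          rw [EventuallyLE, ae_restrict_iff' measurableSet_ball.compl]
          refine ae_of_all _ fun y hy => ?_
          have := hpos y hy
          simp only [Pi.zero_apply]; positivity
  have htot := hcomplete θ hθ
  rw [← Set.Ioc_union_Ioi_eq_Ioi (show (0:ℝ) ≤ R2 by linarith)] at htot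
  have := lintegral_union_le (μ := volume)
    (fun r : ℝ => ENNReal.ofReal (Real.exp (u (r • θ)))) (Set.Ioc 0 R2) (Set.Ioi R2)
  rw [htot] at this
  exact absurd (lt_of_le_of_lt this (ENNReal.add_lt_top.2 ⟨hfin1, hfin2⟩)) (lt_irrefl _)
end
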